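/- arXiv:1609.01425 — 4 statements merged into one kernel-verified Lean document; each statement's English description precedes it below -/
import Mathlib

section
/- Let G be a connected simple graph on n vertices. Then LE_t(G) ≤ n·MD_t(G) + E(G), where t is the 2-degree vertex weight. Moreover, equality holds if and only if G is 2-degree regular. -/
open Matrix Finset

set_option linter.unusedSectionVars false

variable {V : Type*} [Fintype V] [DecidableEq V]

/-- The adjacency matrix of a simple graph over `ℝ` is Hermitian. -/
lemma adjMatrix_isHermitian (G : SimpleGraph V) [DecidableRel G.Adj] :
    (G.adjMatrix ℝ).IsHermitian :=
  Matrix.IsHermitian.ext fun i j => by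
    simp [Matrix.IsHermitian, SimpleGraph.adjMatrix_apply, SimpleGraph.adj_comm]

/-- The weighted Laplacian matrix `D_ω(G) - A(G)` of a simple graph with
vertex weight `w`. -/
noncomputable def wLaplacian (G : SimpleGraph V) [DecidableRel G.Adj] (w : V → ℝ) :
    Matrix V V ℝ :=
  Matrix.diagonal w - G.adjMatrix ℝ

lemma wLaplacian_isHermitian (G : SimpleGraph V) [DecidableRel G.Adj] (w : V → ℝ) :
    (wLaplacian G w).IsHermitian :=
  (Matrix.isHermitian_diagonal w).sub (adjMatrix_isHermitian G)

/-- The energy of a graph: the sum of the absolute values of the eigenvalues of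
its adjacency matrix, `E(G) = Σ_i |λ_i|`. -/
noncomputable def graphEnergy (G : SimpleGraph V) [DecidableRel G.Adj] : ℝ :=
  ∑ i, |(adjMatrix_isHermitian G).eigenvalues i|

/-- The average `ω̄ = (Σ_v ω(v))/n` of a vertex weight. -/
noncomputable def avgWeight (w : V → ℝ) : ℝ :=
  (∑ v, w v) / (Fintype.card V : ℝ)

/-- The Laplacian energy of `G` with respect to the vertex weight `w`:
`LE_ω(G) = Σ_i |μ_i − ω̄|` where the `μ_i` are the eigenvalues of
`D_ω(G) - A(G)`. -/
noncomputable def wLapEnergy (G : SimpleGraph V) [DecidableRel G.Adj] (w : V → ℝ) : ℝ :=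
  ∑ i, |(wLaplacian_isHermitian G w).eigenvalues i - avgWeight w|

/-- The mean deviation of a vertex weight: `MD_ω(G) = (1/n) Σ_v |ω(v) − ω̄|`. -/
noncomputable def meanDev (w : V → ℝ) : ℝ :=
  (∑ v, |w v - avgWeight w|) / (Fintype.card V : ℝ)

/-- The 2-degree of a vertex: the sum of the degrees of its neighbours. -/
def twoDeg (G : SimpleGraph V) [DecidableRel G.Adj] (u : V) : ℝ :=
  ∑ v ∈ G.neighborFinset u, (G.degree v : ℝ)


def SymInv (S : Matrix V V ℝ) : Prop := Sᵀ = S ∧ S * S = 1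

lemma SymInv.row {S : Matrix V V ℝ} (h : SymInv S) (i : V) : ∑ k, S i k ^ 2 = 1 := by
  have := congrFun (congrFun h.2 i) i
  rw [Matrix.mul_apply, Matrix.one_apply_eq] at this
  rw [← this]
  refine Finset.sum_congr rfl fun k _ => ?_
  have h2 : S k i = S i k := congrFun (congrFun h.1 i) k
  rw [h2, sq]

lemma SymInv.abs_le {S : Matrix V V ℝ} (h : SymInv S) (i : V) : |S i i| ≤ 1 := by
  have h1 := h.row i
  have h2 := Finset.single_le_sum (f := fun k => S i k ^ 2) (fun k _ => sq_nonneg _)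
    (Finset.mem_univ i)
  rw [h1] at h2
  exact (sq_le_one_iff_abs_le_one _).1 h2

lemma SymInv.off {S : Matrix V V ℝ} (h : SymInv S) (i : V) (hi : |S i i| = 1) (k : V)
    (hk : k ≠ i) : S i k = 0 := by
  have h1 := h.row i
  rw [← Finset.add_sum_erase _ _ (Finset.mem_univ i), ← sq_abs, hi] at h1
  have h2 : ∑ k ∈ Finset.univ.erase i, S i k ^ 2 = 0 := by linarith
  rw [Finset.sum_eq_zero_iff_of_nonneg (fun k _ => sq_nonneg _)] at h2
  have := h2 k (by simp [hk])
  simpa using this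

lemma SymInv.neg {S : Matrix V V ℝ} (h : SymInv S) : SymInv (-S) := by
  refine ⟨?_, ?_⟩
  · rw [Matrix.transpose_neg, h.1]
  · rw [neg_mul_neg, h.2]

lemma SymInv.conj {S W : Matrix V V ℝ} (h : SymInv S) (hW : W * Wᵀ = 1) :
    SymInv (Wᵀ * S * W) := by
  refine ⟨?_, ?_⟩
  · simp [Matrix.transpose_mul, h.1, Matrix.mul_assoc]
  · calc Wᵀ * S * W * (Wᵀ * S * W) = Wᵀ * S * (W * Wᵀ) * S * W := by
          simp only [Matrix.mul_assoc]
      _ = Wᵀ * (S * S) * W := by rw [hW]; simp only [Matrix.mul_assoc, Matrix.mul_one]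
      _ = 1 := by rw [h.2, Matrix.mul_one, mul_eq_one_comm.1 hW]

lemma trace_symconj (S W : Matrix V V ℝ) (l : V → ℝ) :
    (S * (W * diagonal l * Wᵀ)).trace = ∑ j, (Wᵀ * S * W) j j * l j := by
  have : (S * (W * diagonal l * Wᵀ)).trace = ((Wᵀ * S * W) * diagonal l).trace := by
    rw [← Matrix.mul_assoc, Matrix.trace_mul_comm]
    simp only [Matrix.mul_assoc]
  rw [this, Matrix.trace]
  simp [Matrix.mul_diagonal]

lemma term_le {a l : ℝ} (h : |a| ≤ 1) : a * l ≤ |l| := by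
  calc a * l ≤ |a * l| := le_abs_self _
    _ = |a| * |l| := abs_mul _ _
    _ ≤ 1 * |l| := by gcongr
    _ = |l| := one_mul _

lemma trace_le {S W : Matrix V V ℝ} (h : SymInv S) (hW : W * Wᵀ = 1) (l : V → ℝ) :
    (S * (W * diagonal l * Wᵀ)).trace ≤ ∑ j, |l j| := by
  rw [trace_symconj]
  exact Finset.sum_le_sum fun j _ => term_le ((h.conj hW).abs_le j)

lemma exists_sign (W : Matrix V V ℝ) (hW : W * Wᵀ = 1) (l : V → ℝ) :
    ∃ S, SymInv S ∧ (S * (W * diagonal l * Wᵀ)).trace = ∑ j, |l j| := by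
  have hW' : Wᵀ * W = 1 := mul_eq_one_comm.1 hW
  let s : V → ℝ := fun j => if 0 ≤ l j then 1 else -1
  have hs : SymInv (diagonal s) := by
    refine ⟨by simp, ?_⟩
    rw [Matrix.diagonal_mul_diagonal, ← Matrix.diagonal_one]
    congr 1
    ext j
    by_cases h : 0 ≤ l j <;> simp [s, h]
  have h1 := hs.conj (W := Wᵀ) (by simpa using hW')
  rw [Matrix.transpose_transpose] at h1
  refine ⟨_, h1, ?_⟩
  rw [trace_symconj]
  have : Wᵀ * (W * diagonal s * Wᵀ) * W = diagonal s := by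
    calc _ = (Wᵀ * W) * diagonal s * (Wᵀ * W) := by simp only [Matrix.mul_assoc]
      _ = _ := by simp [hW']
  rw [this]
  refine Finset.sum_congr rfl fun j _ => ?_
  by_cases h : 0 ≤ l j
  · simp [s, h, abs_of_nonneg h]
  · simp [s, h, abs_of_neg (not_le.1 h)]

lemma exists_diag {A : Matrix V V ℝ} (hA : A.IsHermitian) :
    ∃ W : Matrix V V ℝ, W * Wᵀ = 1 ∧ A = W * diagonal hA.eigenvalues * Wᵀ := by
  refine ⟨hA.eigenvectorUnitary, ?_, ?_⟩
  · have := (Matrix.mem_unitaryGroup_iff).1 hA.eigenvectorUnitary.2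
    simpa [Matrix.star_eq_conjTranspose, Matrix.conjTranspose_eq_transpose_of_trivial] using this
  · have := hA.spectral_theorem
    rw [Unitary.conjStarAlgAut_apply] at this
    simpa [Matrix.star_eq_conjTranspose, Matrix.conjTranspose_eq_transpose_of_trivial,
      Function.comp_def] using this

lemma wLap_main (G : SimpleGraph V) [DecidableRel G.Adj] (hG : G.Connected) (w : V → ℝ) :
    wLapEnergy G w ≤ (Fintype.card V : ℝ) * meanDev w + graphEnergy G ∧
    (wLapEnergy G w = (Fintype.card V : ℝ) * meanDev w + graphEnergy G ↔
      ∀ u v : V, w u = w v) := by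
  have hne := hG.nonempty
  have hcard : (Fintype.card V : ℝ) ≠ 0 := by
    exact_mod_cast Fintype.card_ne_zero
  have hmd : (Fintype.card V : ℝ) * meanDev w = ∑ v, |w v - avgWeight w| := by
    rw [meanDev, mul_div_cancel₀ _ hcard]
  rw [hmd]
  obtain ⟨W, hW, hA⟩ := exists_diag (adjMatrix_isHermitian G)
  obtain ⟨U, hU, hL⟩ := exists_diag (wLaplacian_isHermitian G w)
  unfold wLapEnergy graphEnergy
  set l := (adjMatrix_isHermitian G).eigenvalues
  set m := (wLaplacian_isHermitian G w).eigenvalues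
  set c := avgWeight w with hc
  have hM : U * diagonal (fun i => m i - c) * Uᵀ
      = diagonal (fun i => w i - c) - G.adjMatrix ℝ := by
    have e1 : ∀ f : V → ℝ, diagonal (fun i => f i - c) = diagonal f - c • (1 : Matrix V V ℝ) := by
      intro f
      ext i j
      by_cases h : i = j
      · subst h; simp
      · simp [h]
    rw [e1, e1, Matrix.mul_sub, Matrix.sub_mul, ← hL, wLaplacian]
    simp only [Matrix.mul_smul, Matrix.smul_mul, Matrix.mul_one, hU]
    abel
  obtain ⟨S, hS, hSt⟩ := exists_sign U hU (fun i => m i - c)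
  have hT := hS.neg.conj hW
  set T := Wᵀ * (-S) * W with hTdef
  have hsum : ∑ i, |m i - c| = ∑ i, S i i * (w i - c) + ∑ j, T j j * l j := by
    rw [← hSt, hM, hTdef, ← trace_symconj, ← hA, Matrix.mul_sub, Matrix.trace_sub, Matrix.neg_mul,
      Matrix.trace_neg, sub_eq_add_neg]
    congr 1
    simp [Matrix.trace, Matrix.mul_diagonal]
  have hi1 : ∀ i ∈ Finset.univ, S i i * (w i - c) ≤ |w i - c| := fun i _ => term_le (hS.abs_le i)
  have hi2 : ∀ j ∈ Finset.univ, T j j * l j ≤ |l j| := fun j _ => term_le (hT.abs_le j)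
  have hs1 := Finset.sum_le_sum hi1
  have hs2 := Finset.sum_le_sum hi2
  refine ⟨by rw [hsum]; exact add_le_add hs1 hs2, ?_, ?_⟩
  · intro heq
    rw [hsum] at heq
    have q1 := (Finset.sum_eq_sum_iff_of_le hi1).1 (by linarith)
    have q2 := (Finset.sum_eq_sum_iff_of_le hi2).1 (by linarith)
    have habs : ∀ a x : ℝ, a * x = |x| → x ≠ 0 → |a| = 1 := by
      intro a x h hx
      have h1 : |a| * |x| = |x| := by rw [← abs_mul, h, abs_abs]
      exact (mul_eq_right₀ (abs_ne_zero.2 hx)).1 h1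
    have hTl : T * diagonal l = diagonal (fun j => |l j|) := by
      ext k j
      rw [Matrix.mul_diagonal]
      by_cases hkj : k = j
      · subst hkj
        rw [q2 k (Finset.mem_univ _), Matrix.diagonal_apply_eq]
      · rw [Matrix.diagonal_apply_ne _ hkj]
        by_cases hl : l j = 0
        · simp [hl]
        · have := hT.off j (habs _ _ (q2 j (Finset.mem_univ _)) hl) k hkj
          have h2 : T k j = T j k := congrFun (congrFun hT.1 j) k
          rw [h2, this, zero_mul]
    have hSA : (-S) * G.adjMatrix ℝ = W * diagonal (fun j => |l j|) * Wᵀ := by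
      rw [← hTl, hTdef, hA]
      calc _ = 1 * (-S) * (W * diagonal l * Wᵀ) := by rw [Matrix.one_mul]
        _ = _ := by rw [← hW]; simp only [Matrix.mul_assoc]
    have hzero : ∀ i, w i - c = 0 := by
      intro i
      by_contra hd
      have hoff := hS.off i (habs _ _ (q1 i (Finset.mem_univ _)) hd)
      have h0 : ((-S) * G.adjMatrix ℝ) i i = 0 := by
        rw [Matrix.mul_apply]
        refine Finset.sum_eq_zero fun k _ => ?_
        by_cases hk : k = i
        · subst hk; simp
        · simp [hoff k hk]
      rw [hSA, Matrix.mul_apply] at h0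
      simp only [Matrix.mul_diagonal, Matrix.transpose_apply] at h0
      rw [Finset.sum_eq_zero_iff_of_nonneg (fun j _ => by
        have : W i j * |l j| * W i j = W i j ^ 2 * |l j| := by ring
        rw [this]; positivity)] at h0
      have hiso : ∀ k, G.adjMatrix ℝ i k = 0 := by
        intro k
        rw [hA, Matrix.mul_apply]
        refine Finset.sum_eq_zero fun j _ => ?_
        have := h0 j (Finset.mem_univ _)
        rw [Matrix.mul_diagonal]
        have : W i j = 0 ∨ l j = 0 := by
          simp only [mul_eq_zero, abs_eq_zero] at this
          tauto
        rcases this with h | h <;> simp [h]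
      have hiso' : ∀ k, ¬ G.Adj i k := by
        intro k hk
        have := hiso k
        simp [SimpleGraph.adjMatrix_apply, hk] at this
      rcases subsingleton_or_nontrivial V with hV | hV
      · apply hd
        have : ∀ v, w v = w i := fun v => by rw [Subsingleton.elim v i]
        rw [hc, avgWeight]
        simp only [this, Finset.sum_const, Finset.card_univ, nsmul_eq_mul]
        rw [mul_div_cancel_left₀ _ hcard, sub_self]
      · obtain ⟨k, hk⟩ := hG.preconnected.exists_adj_of_nontrivial i
        exact hiso' k hk
    intro u v
    linarith [hzero u, hzero v]
  · intro hreg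
    have hz : ∀ i, w i - c = 0 := by
      intro i
      have : ∀ v, w v = w i := fun v => hreg v i
      rw [hc, avgWeight]
      simp only [this, Finset.sum_const, Finset.card_univ, nsmul_eq_mul]
      rw [mul_div_cancel_left₀ _ hcard, sub_self]
    simp only [hz, abs_zero, Finset.sum_const_zero, mul_zero, zero_add, Matrix.diagonal_zero,
      zero_sub] at *
    apply le_antisymm
    · linarith
    · obtain ⟨R, hR, hRt⟩ := exists_sign W hW l
      rw [← hRt, ← hA]
      have := trace_le hR.neg hU (fun i => m i - c)
      rw [hM] at this
      simpa using this

theorem wLapEnergy_twoDeg_le (G : SimpleGraph V) [DecidableRel G.Adj]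
    (hG : G.Connected) :
    wLapEnergy G (twoDeg G) ≤ (Fintype.card V : ℝ) * meanDev (twoDeg G) + graphEnergy G ∧
    (wLapEnergy G (twoDeg G) = (Fintype.card V : ℝ) * meanDev (twoDeg G) + graphEnergy G ↔
      ∀ u v : V, twoDeg G u = twoDeg G v) := by
  exact wLap_main G hG (twoDeg G)
end

section
/- Let G be a bipartite simple graph on n vertices. Then LE_t(G) ≥ E(G), where t is the 2-degree vertex weight. Moreover, equality holds if and only if G is 2-degree regular. -/
open Matrix Finset

set_option linter.unusedSectionVars false

variable {V : Type*} [Fintype V] [DecidableEq V]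

lemma aux_diag {L : Matrix V V ℝ} (hL : L.IsHermitian) (τ : ℝ) :
    ∃ U : Matrix V V ℝ, Uᵀ * U = 1 ∧ U * Uᵀ = 1 ∧
      L - τ • (1 : Matrix V V ℝ) = U * diagonal (fun i => hL.eigenvalues i - τ) * Uᵀ := by
  refine ⟨(hL.eigenvectorUnitary : Matrix V V ℝ), ?_, ?_, ?_⟩
  · have := Unitary.coe_star_mul_self hL.eigenvectorUnitary
    simpa [star_eq_conjTranspose, conjTranspose_eq_transpose_of_trivial] using this
  · have := Unitary.coe_mul_star_self hL.eigenvectorUnitary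
    simpa [star_eq_conjTranspose, conjTranspose_eq_transpose_of_trivial] using this
  · have h1 := hL.spectral_theorem
    have h2 := Unitary.coe_mul_star_self hL.eigenvectorUnitary
    rw [Unitary.conjStarAlgAut_apply] at h1
    simp only [Unitary.coe_star, star_eq_conjTranspose, conjTranspose_eq_transpose_of_trivial] at h1 h2
    have h3 : (diagonal (fun i => hL.eigenvalues i - τ) : Matrix V V ℝ)
      = diagonal (RCLike.ofReal ∘ hL.eigenvalues) - τ • (1 : Matrix V V ℝ) := by
      ext i j
      by_cases h : i = j
      · subst h; simp
      · simp [h]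
    rw [h3, mul_sub, sub_mul, ← h1]
    simp [h2]

lemma aux_abs_sign (x : ℝ) : SignType.sign x * x = |x| := by
  rcases lt_trichotomy x 0 with h | h | h
  · simp [h, abs_of_neg]
  · simp [h]
  · simp [h, abs_of_pos]

lemma aux_sign_abs (x : ℝ) : SignType.sign x * |x| = x := by
  rcases lt_trichotomy x 0 with h | h | h
  · simp [h, abs_of_neg]
  · simp [h]
  · simp [h, abs_of_pos]

lemma aux_conj {U : Matrix V V ℝ} (h1 : Uᵀ * U = 1) (a b : Matrix V V ℝ) :
    (U * a * Uᵀ) * (U * b * Uᵀ) = U * (a * b) * Uᵀ := by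
  calc _ = U * a * (Uᵀ * U) * b * Uᵀ := by simp only [mul_assoc]
    _ = _ := by rw [h1]; simp only [mul_assoc, one_mul, mul_one]

lemma aux_psd (U : Matrix V V ℝ) {f : V → ℝ} (hf : ∀ i, 0 ≤ f i) :
    (U * diagonal f * Uᵀ).PosSemidef := by
  have := (PosSemidef.diagonal (n := V) (d := f) hf).mul_mul_conjTranspose_same U
  simpa [conjTranspose_eq_transpose_of_trivial] using this

lemma exists_sgn {L : Matrix V V ℝ} (hL : L.IsHermitian) (τ : ℝ) (N : Matrix V V ℝ)
    (hN : N = L - τ • (1 : Matrix V V ℝ)) :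
    ∃ P : Matrix V V ℝ, Pᵀ = P ∧ P * N = N * P ∧ (P * N).PosSemidef ∧
      (P * N).trace = ∑ i, |hL.eigenvalues i - τ| ∧ P * P * N = N ∧
      (1 - P * P).PosSemidef ∧
      (∀ B, N * B = B * N → P * B = B * P) ∧ (∀ B, N * B = -(B * N) → P * B = -(B * P)) := by
  obtain ⟨U, h1, h2, h3⟩ := aux_diag hL τ
  rw [← hN] at h3
  set ν : V → ℝ := fun i => hL.eigenvalues i - τ with hν
  set sg : V → ℝ := fun i => (SignType.sign (ν i) : ℝ) with hsg
  have hcan : ∀ M M' : Matrix V V ℝ, Uᵀ * M * U = Uᵀ * M' * U → M = M' := by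
    intro M M' h
    calc M = (U * Uᵀ) * M * (U * Uᵀ) := by rw [h2]; simp
      _ = U * (Uᵀ * M * U) * Uᵀ := by simp only [mul_assoc]
      _ = (U * Uᵀ) * M' * (U * Uᵀ) := by rw [h]; simp only [mul_assoc]
      _ = M' := by rw [h2]; simp
  have hl : ∀ (f : V → ℝ) (B : Matrix V V ℝ), Uᵀ * (U * diagonal f * Uᵀ * B) * U
      = diagonal f * (Uᵀ * B * U) := by
    intro f B
    calc _ = (Uᵀ * U) * diagonal f * (Uᵀ * B * U) := by simp only [mul_assoc]
      _ = _ := by rw [h1, one_mul]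
  have hr : ∀ (f : V → ℝ) (B : Matrix V V ℝ), Uᵀ * (B * (U * diagonal f * Uᵀ)) * U
      = (Uᵀ * B * U) * diagonal f := by
    intro f B
    calc _ = (Uᵀ * B * U) * diagonal f * (Uᵀ * U) := by simp only [mul_assoc]
      _ = _ := by rw [h1, mul_one]
  have hPN : U * diagonal sg * Uᵀ * N = U * diagonal (fun i => |ν i|) * Uᵀ := by
    rw [h3, aux_conj h1, diagonal_mul_diagonal]
    simp only [hsg, aux_abs_sign]
  refine ⟨U * diagonal sg * Uᵀ, ?_, ?_, ?_, ?_, ?_, ?_, ?_, ?_⟩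
  · simp [transpose_mul, mul_assoc]
  · rw [h3, aux_conj h1, aux_conj h1, diagonal_mul_diagonal, diagonal_mul_diagonal]
    simp only [mul_comm]
  · rw [hPN]; exact aux_psd U (fun i => abs_nonneg _)
  · rw [hPN, trace_mul_comm, ← mul_assoc, h1, one_mul, trace_diagonal]
  · rw [mul_assoc, hPN, aux_conj h1, diagonal_mul_diagonal]
    simp only [hsg, aux_sign_abs]
    exact h3.symm
  · have : (1 : Matrix V V ℝ) - U * diagonal sg * Uᵀ * (U * diagonal sg * Uᵀ)
      = U * diagonal (fun i => 1 - sg i * sg i) * Uᵀ := by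
      rw [aux_conj h1, diagonal_mul_diagonal, ← diagonal_sub, diagonal_one, mul_sub, sub_mul]
      simp [h2]
    rw [this]
    refine aux_psd U (fun i => ?_)
    rcases lt_trichotomy (ν i) 0 with h | h | h <;> simp [hsg, h]
  · intro B hB
    apply hcan
    rw [hl, hr]
    have h4 : diagonal ν * (Uᵀ * B * U) = (Uᵀ * B * U) * diagonal ν := by
      rw [← hl, ← hr, ← h3, hB]
    ext i j
    have h5 := congrFun (congrFun h4 i) j
    simp only [diagonal_mul, mul_diagonal] at h5 ⊢
    by_cases h6 : (Uᵀ * B * U) i j = 0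
    · simp [h6]
    · have h7 : ν i = ν j := by
        apply mul_right_cancel₀ h6; linarith
      simp only [hsg, h7]; ring
  · intro B hB
    apply hcan
    rw [mul_neg, neg_mul, hl, hr]
    have h4 : diagonal ν * (Uᵀ * B * U) = -((Uᵀ * B * U) * diagonal ν) := by
      rw [← hl, ← hr, ← h3, hB, mul_neg, neg_mul]
    ext i j
    have h5 := congrFun (congrFun h4 i) j
    rw [Matrix.neg_apply] at h5 ⊢
    simp only [diagonal_mul, mul_diagonal] at h5 ⊢
    by_cases h6 : (Uᵀ * B * U) i j = 0
    · simp [h6]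
    · have h7 : ν i = - ν j := by
        apply mul_right_cancel₀ h6; linarith
      simp only [hsg, h7, Left.sign_neg, SignType.coe_neg]; ring

lemma trace_le_s7 {L : Matrix V V ℝ} (hL : L.IsHermitian) (τ : ℝ) (N : Matrix V V ℝ)
    (hN : N = L - τ • (1 : Matrix V V ℝ)) (P : Matrix V V ℝ) (hs : Pᵀ = P)
    (hc : (1 - P * P).PosSemidef) :
    (P * N).trace ≤ ∑ i, |hL.eigenvalues i - τ| ∧
    ((P * N).trace = ∑ i, |hL.eigenvalues i - τ| → (P * N).PosSemidef ∧ P * P * N = N) := by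
  obtain ⟨U, h1, h2, h3⟩ := aux_diag hL τ
  rw [← hN] at h3
  set ν : V → ℝ := fun i => hL.eigenvalues i - τ with hν
  set T : Matrix V V ℝ := Uᵀ * P * U with hT
  have hTs : Tᵀ = T := by simp [hT, transpose_mul, mul_assoc, hs]
  have hPT : P = U * T * Uᵀ := by
    calc P = (U * Uᵀ) * P * (U * Uᵀ) := by rw [h2]; simp
      _ = _ := by simp only [hT, mul_assoc]
  have hPN : P * N = U * (T * diagonal ν) * Uᵀ := by
    rw [h3]; nth_rw 1 [hPT]; rw [aux_conj h1]
  have htr : (P * N).trace = ∑ i, T i i * ν i := by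
    rw [hPN, trace_mul_comm, ← mul_assoc, h1, one_mul]
    simp [trace, mul_diagonal]
  have hrow : ∀ i, ∑ j, T i j ^ 2 ≤ 1 := by
    intro i
    have h4 : (Uᵀ * (1 - P * P) * U).PosSemidef := by
      have := hc.mul_mul_conjTranspose_same Uᵀ
      simpa [conjTranspose_eq_transpose_of_trivial] using this
    have h5 : Uᵀ * (1 - P * P) * U = 1 - T * T := by
      have : T * T = Uᵀ * (P * P) * U := by
        calc T * T = Uᵀ * P * (U * Uᵀ) * P * U := by simp only [hT, mul_assoc]
          _ = _ := by rw [h2]; simp [mul_assoc]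
      rw [this, mul_sub, sub_mul, mul_one, h1]
    rw [h5] at h4
    have h6 := h4.diag_nonneg (i := i)
    rw [Matrix.sub_apply, one_apply_eq, mul_apply] at h6
    have h7 : ∀ j, T i j * T j i = T i j ^ 2 := by
      intro j
      have : T j i = T i j := congrFun (congrFun hTs i) j
      rw [this]; ring
    simp only [h7] at h6
    linarith
  have habs : ∀ i, |T i i| ≤ 1 := by
    intro i
    have : T i i ^ 2 ≤ ∑ j, T i j ^ 2 :=
      Finset.single_le_sum (f := fun j => T i j ^ 2) (fun j _ => sq_nonneg _) (mem_univ i)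
    rw [← sq_le_one_iff_abs_le_one]; linarith [hrow i]
  have hterm : ∀ i, T i i * ν i ≤ |ν i| := by
    intro i
    calc T i i * ν i ≤ |T i i * ν i| := le_abs_self _
      _ = |T i i| * |ν i| := abs_mul _ _
      _ ≤ 1 * |ν i| := by gcongr; exact habs i
      _ = _ := one_mul _
  refine ⟨by rw [htr]; exact Finset.sum_le_sum fun i _ => hterm i, ?_⟩
  intro heq
  rw [htr] at heq
  have h4 := (Finset.sum_eq_sum_iff_of_le (fun i _ => hterm i)).1 heq
  have hd : ∀ i j, ν j ≠ 0 → T i j = if i = j then (SignType.sign (ν j) : ℝ) else 0 := by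
    intro i j hj
    have h5 := h4 j (mem_univ j)
    have h6 : T j j = (SignType.sign (ν j) : ℝ) := by
      rw [← aux_abs_sign] at h5
      exact mul_right_cancel₀ hj h5
    by_cases hij : i = j
    · subst hij; simp [h6]
    · rw [if_neg hij]
      have h7 : T j j ^ 2 = 1 := by
        rw [h6]
        rcases lt_or_gt_of_ne hj with h | h <;> simp [h]
      have h8 : T j j ^ 2 + T j i ^ 2 ≤ ∑ k, T j k ^ 2 := by
        rw [← Finset.sum_pair (f := fun k => T j k ^ 2) (fun h => hij h.symm)]
        exact Finset.sum_le_sum_of_subset_of_nonneg (subset_univ _) (fun _ _ _ => sq_nonneg _)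
      have h9 : T j i ^ 2 = 0 := le_antisymm (by linarith [hrow j]) (sq_nonneg _)
      have : T j i = T i j := congrFun (congrFun hTs i) j
      rw [← this]; exact pow_eq_zero_iff (two_ne_zero) |>.1 h9
  have hTν : T * diagonal ν = diagonal (fun i => |ν i|) := by
    ext i j
    rw [mul_diagonal]
    by_cases hj : ν j = 0
    · by_cases hij : i = j
      · subst hij; simp [hj]
      · simp [hj, hij]
    · rw [hd i j hj]
      by_cases hij : i = j
      · subst hij; simp [aux_abs_sign]
      · simp [hij]
  have hTa : T * diagonal (fun i => |ν i|) = diagonal ν := by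
    ext i j
    rw [mul_diagonal]
    by_cases hj : ν j = 0
    · by_cases hij : i = j
      · subst hij; simp [hj]
      · simp [hj, hij]
    · rw [hd i j hj]
      by_cases hij : i = j
      · subst hij; simp [aux_sign_abs]
      · simp [hij]
  rw [hTν] at hPN
  refine ⟨by rw [hPN]; exact aux_psd U fun i => abs_nonneg _, ?_⟩
  rw [mul_assoc, hPN]; nth_rw 1 [hPT]; rw [aux_conj h1, hTa, ← h3]

structure EqP (G : SimpleGraph V) [DecidableRel G.Adj] (g s : V → ℝ) (P : Matrix V V ℝ) :
    Prop where
  symm : ∀ u v, P u v = P v u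
  psd : (P * G.adjMatrix ℝ - P * diagonal g).PosSemidef
  hR : (P * G.adjMatrix ℝ).PosSemidef
  comm : P * G.adjMatrix ℝ = G.adjMatrix ℝ * P
  sq : ∀ u v, g u ≠ 0 → ∑ w, P u w * P w v = if u = v then 1 else 0
  supp_g : ∀ u v, P u v ≠ 0 → g u = g v
  fcomm : ∀ f : V → ℝ, (∀ u v, G.Adj u v → f u = f v) → ∀ u v, P u v ≠ 0 → f u = f v
  hs : ∀ u, s u = 1 ∨ s u = -1
  adj_s : ∀ u v, G.Adj u v → s u = - s v
  supp_s : ∀ u v, P u v ≠ 0 → s u = - s v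

lemma extract (G : SimpleGraph V) [DecidableRel G.Adj] (hG : G.Colorable 2) (w : V → ℝ) :
    graphEnergy G ≤ wLapEnergy G w ∧ (wLapEnergy G w = graphEnergy G →
      ∃ s P, EqP G (fun u => w u - avgWeight w) s P) := by
  obtain ⟨col⟩ := hG
  set τ := avgWeight w with hτ
  set A := G.adjMatrix ℝ with hA
  set s : V → ℝ := fun u => if col u = 0 then 1 else -1 with hsdef
  have hs : ∀ u, s u = 1 ∨ s u = -1 := by
    intro u; by_cases h : col u = 0 <;> simp [hsdef, h]
  have adj_s : ∀ u v, G.Adj u v → s u = - s v := by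
    intro u v huv
    have h := col.valid huv
    simp only [hsdef]
    rcases Fin.exists_fin_two.1 ⟨col u, rfl⟩ with h1 | h1 <;>
    rcases Fin.exists_fin_two.1 ⟨col v, rfl⟩ with h2 | h2 <;> simp_all
  obtain ⟨P, hPs, hPA, hR, htr, hPPA, hc, hcom, hanti⟩ :=
    exists_sgn (adjMatrix_isHermitian G) 0 A (by simp [hA])
  have symm : ∀ u v, P u v = P v u := fun u v => congrFun (congrFun hPs v) u
  have supp_s : ∀ u v, P u v ≠ 0 → s u = - s v := by
    intro u v huv
    have h := hanti (diagonal s) (by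
      ext i j
      rw [Matrix.neg_apply, mul_diagonal, diagonal_mul]
      by_cases hij : G.Adj i j
      · have := adj_s i j hij
        simp [hA, hij, this]
      · simp [hA, hij])
    have h := congrFun (congrFun h u) v
    rw [Matrix.neg_apply, mul_diagonal, diagonal_mul] at h
    apply mul_right_cancel₀ huv; linarith
  have hdiag : ∀ u, P u u = 0 := by
    intro u
    by_contra h
    have := supp_s u u h
    rcases hs u with h1 | h1 <;> rw [h1] at this <;> norm_num at this
  have fcomm : ∀ f : V → ℝ, (∀ u v, G.Adj u v → f u = f v) → ∀ u v, P u v ≠ 0 → f u = f v := by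
    intro f hf u v huv
    have h := hcom (diagonal f) (by
      ext i j
      rw [mul_diagonal, diagonal_mul]
      by_cases hij : G.Adj i j
      · have := hf i j hij
        simp [hA, hij, this]
      · simp [hA, hij])
    have h := congrFun (congrFun h u) v
    rw [mul_diagonal, diagonal_mul] at h
    apply mul_right_cancel₀ huv; linarith
  set g : V → ℝ := fun u => w u - τ with hg
  have hN : diagonal g - A = wLaplacian G w - τ • (1 : Matrix V V ℝ) := by
    ext i j
    by_cases h : i = j
    · subst h; simp [wLaplacian, hg, hA]
    · simp [wLaplacian, hg, hA, h]
  have hPg : (P * diagonal g).trace = 0 := by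
    simp [trace, mul_diagonal, hdiag]
  have hmul : -P * (diagonal g - A) = P * A - P * diagonal g := by
    rw [mul_sub, neg_mul, neg_mul]; abel
  have htr2 : (-P * (diagonal g - A)).trace = graphEnergy G := by
    rw [hmul, trace_sub, hPg, htr, graphEnergy]; simp
  obtain ⟨h1, h2⟩ := trace_le_s7 (wLaplacian_isHermitian G w) τ _ hN (-P) (by simp [hPs])
    (by simpa using hc)
  rw [htr2] at h1 h2
  refine ⟨h1, fun heq => ⟨s, P, ?_⟩⟩
  obtain ⟨h3, h4⟩ := h2 heq.symm
  rw [hmul] at h3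
  have hPD : P * diagonal g = diagonal g * P := by
    have h5 : (P * diagonal g).IsHermitian := by
      have := hR.isHermitian.sub h3.isHermitian
      simpa using this
    have h6 := h5.eq
    rw [conjTranspose_eq_transpose_of_trivial, transpose_mul, diagonal_transpose, hPs] at h6
    exact h6.symm
  have hPPD : P * P * diagonal g = diagonal g := by
    have h5 : P * P * (diagonal g - A) = diagonal g - A := by simpa using h4
    rw [mul_sub, hPPA] at h5
    exact sub_left_injective h5
  refine ⟨symm, h3, hR, hPA, ?_, ?_, fcomm, hs, adj_s, supp_s⟩
  · intro u v hu
    have h5 : diagonal g * (P * P) = diagonal g := by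
      rw [← mul_assoc, ← hPD, mul_assoc, ← hPD, ← mul_assoc, hPPD]
    have h6 := congrFun (congrFun h5 u) v
    rw [diagonal_mul, mul_apply] at h6
    apply mul_left_cancel₀ hu
    rw [h6]
    by_cases huv : u = v
    · subst huv; simp
    · simp [huv]
  · intro u v huv
    have h := congrFun (congrFun hPD u) v
    rw [mul_diagonal, diagonal_mul] at h
    apply mul_right_cancel₀ huv; linarith

lemma const_of_cs (S : Finset V) (z : V → ℝ) (h : (S.card : ℝ) * ∑ a ∈ S, z a ^ 2 ≤ (∑ a ∈ S, z a) ^ 2)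
    {a b : V} (ha : a ∈ S) (hb : b ∈ S) : z a = z b := by
  set m : ℝ := (S.card : ℝ) with hm
  set T := ∑ a ∈ S, z a with hT
  have h0 : ∑ a ∈ S, (m * z a - T) ^ 2 = m * (m * ∑ a ∈ S, z a ^ 2 - T ^ 2) := by
    have : ∀ a, (m * z a - T) ^ 2 = m ^ 2 * z a ^ 2 - 2 * m * T * z a + T ^ 2 := by
      intro a; ring
    simp only [this, Finset.sum_add_distrib, Finset.sum_sub_distrib, ← Finset.mul_sum, ← hT]
    simp only [Finset.sum_const, nsmul_eq_mul, ← hm]; ring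
  have hmpos : 0 < m := by
    rw [hm]; exact_mod_cast Finset.card_pos.2 ⟨a, ha⟩
  have h1 : ∑ a ∈ S, (m * z a - T) ^ 2 ≤ 0 := by
    rw [h0]; exact mul_nonpos_of_nonneg_of_nonpos hmpos.le (by linarith)
  have h2 := (Finset.sum_eq_zero_iff_of_nonneg (fun a _ => sq_nonneg (m * z a - T))).1
    (le_antisymm h1 (Finset.sum_nonneg fun a _ => sq_nonneg _))
  have h3 := pow_eq_zero_iff (two_ne_zero) |>.1 (h2 a ha)
  have h4 := pow_eq_zero_iff (two_ne_zero) |>.1 (h2 b hb)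
  apply mul_left_cancel₀ hmpos.ne'
  linarith

namespace EqP

variable {G : SimpleGraph V} [DecidableRel G.Adj] {g s : V → ℝ} {P : Matrix V V ℝ}

lemma transp (h : EqP G g s P) : Pᵀ = P := by
  ext u v; exact h.symm v u

lemma dotP (h : EqP G g s P) (x y : V → ℝ) : x ⬝ᵥ (P *ᵥ y) = (P *ᵥ x) ⬝ᵥ y := by
  rw [dotProduct_mulVec, ← mulVec_transpose, h.transp]

lemma dotA (G : SimpleGraph V) [DecidableRel G.Adj] (x y : V → ℝ) :
    x ⬝ᵥ (G.adjMatrix ℝ *ᵥ y) = (G.adjMatrix ℝ *ᵥ x) ⬝ᵥ y := by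
  rw [dotProduct_mulVec, ← mulVec_transpose, SimpleGraph.transpose_adjMatrix]

lemma qf (h : EqP G g s P) (x : V → ℝ) :
    x ⬝ᵥ ((P * G.adjMatrix ℝ - P * diagonal g) *ᵥ x) =
      (P *ᵥ x) ⬝ᵥ (G.adjMatrix ℝ *ᵥ x) - (P *ᵥ x) ⬝ᵥ (fun v => g v * x v) := by
  have : diagonal g *ᵥ x = fun v => g v * x v := by
    ext v; rw [mulVec_diagonal]
  rw [sub_mulVec, dotProduct_sub, ← mulVec_mulVec, ← mulVec_mulVec, h.dotP, h.dotP, this]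

lemma qf_nonneg (h : EqP G g s P) (x : V → ℝ) :
    0 ≤ (P *ᵥ x) ⬝ᵥ (G.adjMatrix ℝ *ᵥ x) - (P *ᵥ x) ⬝ᵥ (fun v => g v * x v) := by
  rw [← h.qf]
  simpa using h.psd.dotProduct_mulVec_nonneg x

lemma sq' (h : EqP G g s P) {u : V} (hu : g u ≠ 0) (v : V) :
    ∑ w, P v w * P w u = if u = v then 1 else 0 := by
  rw [← h.sq u v hu]
  refine Finset.sum_congr rfl fun w _ => ?_
  rw [h.symm v w, h.symm w u]; ring

lemma row_sq (h : EqP G g s P) {u : V} (hu : g u ≠ 0) : ∑ v, P v u ^ 2 = 1 := by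
  have := h.sq u u hu
  rw [if_pos rfl] at this
  rw [← this]
  refine Finset.sum_congr rfl fun w _ => ?_
  rw [h.symm u w]; ring

lemma diag0 (h : EqP G g s P) (u : V) : P u u = 0 := by
  by_contra h0
  have := h.supp_s u u h0
  rcases h.hs u with h1 | h1 <;> rw [h1] at this <;> norm_num at this

lemma inner_deg (h : EqP G g s P) {u : V} (hu : g u ≠ 0) :
    g u ^ 2 ≤ (((G.neighborFinset u).filter fun v => g v = g u).card : ℝ) := by
  set A := G.adjMatrix ℝ with hA
  set p : V → ℝ := fun v => P v u with hp
  set e : V → ℝ := Pi.single u 1 with he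
  have hPe : P *ᵥ e = p := by
    ext v; simp [he, hp]
  have hPp : P *ᵥ p = e := by
    ext v
    have := h.sq' hu v
    simp only [mulVec, dotProduct, hp, this, he, Pi.single_apply, eq_comm]
  have hAe : A *ᵥ e = fun v => A v u := by
    ext v; simp [he]
  set r : ℝ := ∑ v, A u v * P v u with hr
  have h1 : e ⬝ᵥ (A *ᵥ e) = 0 := by simp [he, hA]
  have h2 : e ⬝ᵥ (A *ᵥ p) = r := by
    rw [he, single_one_dotProduct]; simp [hr, mulVec, dotProduct, hp]
  have h3 : p ⬝ᵥ (A *ᵥ e) = r := by rw [hA, dotA, dotProduct_comm, ← hA, h2]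
  have h4 : p ⬝ᵥ (A *ᵥ p) = 0 := by
    simp only [mulVec, dotProduct, Finset.mul_sum]
    refine Finset.sum_eq_zero fun v _ => Finset.sum_eq_zero fun w _ => ?_
    by_contra hne
    have hv : P v u ≠ 0 := fun h0 => hne (by simp [hp, h0])
    have hw : P w u ≠ 0 := fun h0 => hne (by simp [hp, h0])
    have hvw : G.Adj v w := by
      by_contra h0; exact hne (by simp [hA, h0])
    have a1 := h.supp_s v u hv
    have a2 := h.supp_s w u hw
    have a3 := h.adj_s v w hvw
    rcases h.hs u with a4 | a4 <;> rw [a4] at a1 a2 <;> rw [a1, a2] at a3 <;> norm_num at a3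
  have key : ∀ η : ℝ, η ^ 2 = 1 → η * g u ≤ r := by
    intro η hη
    have hx := h.qf_nonneg (e + η • p)
    have hPx : P *ᵥ (e + η • p) = η • (e + η • p) := by
      rw [mulVec_add, mulVec_smul, hPe, hPp, smul_add, smul_smul, ← pow_two, hη, one_smul, add_comm]
    have hgx : (fun v => g v * (e + η • p) v) = g u • (e + η • p) := by
      ext v
      by_cases hv : v = u
      · subst hv; simp
      · by_cases hpv : P v u = 0
        · simp [he, hp, hv, hpv]
        · have := h.supp_g v u hpv
          simp [this]
    have hee : e ⬝ᵥ e = 1 := by simp [he]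
    have hep : e ⬝ᵥ p = 0 := by simp [he, hp, h.diag0]
    have hpe : p ⬝ᵥ e = 0 := by rw [dotProduct_comm, hep]
    have hpp : p ⬝ᵥ p = 1 := by
      rw [← h.row_sq hu]; simp [dotProduct, hp, pow_two]
    rw [hPx, hgx, ← hA] at hx
    simp only [mulVec_add, mulVec_smul, smul_dotProduct, dotProduct_smul, add_dotProduct,
      dotProduct_add, h1, h2, h3, h4, hee, hep, hpe, hpp, smul_eq_mul] at hx
    have : η * (0 + η * r + η * (r + η * 0)) - η * (g u * (1 + η * 0 + η * (0 + η * 1)))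
        = 2 * η ^ 2 * r - g u * η - g u * η * η ^ 2 := by ring
    rw [hη] at this
    linarith
  have hrabs : |g u| ≤ r := by
    have k1 := key 1 (by norm_num)
    have k2 := key (-1) (by norm_num)
    rw [abs_le]; constructor <;> linarith
  set I := (G.neighborFinset u).filter fun v => g v = g u with hI
  have hrI : r = ∑ v ∈ I, P v u := by
    rw [hr, hI, Finset.sum_filter, ← Finset.sum_filter_add_sum_filter_not univ (fun v => v ∈ G.neighborFinset u)]
    have z2 : ∑ v ∈ univ.filter (fun v => v ∉ G.neighborFinset u), A u v * P v u = 0 := by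
      refine Finset.sum_eq_zero fun v hv => ?_
      have : ¬ G.Adj u v := by simpa using hv
      simp [hA, this]
    rw [z2, add_zero]
    have : univ.filter (fun v => v ∈ G.neighborFinset u) = G.neighborFinset u := by ext v; simp
    rw [this]
    refine Finset.sum_congr rfl fun v hv => ?_
    have hadj : G.Adj u v := by simpa using hv
    by_cases hg : g v = g u
    · simp [hA, hadj, hg]
    · rw [if_neg hg]
      have : P v u = 0 := by
        by_contra h0; exact hg (h.supp_g v u h0)
      simp [this]
  have hcs := sq_sum_le_card_mul_sum_sq (s := I) (f := fun v => P v u)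
  have hle : ∑ v ∈ I, P v u ^ 2 ≤ 1 := by
    rw [← h.row_sq hu]
    exact Finset.sum_le_sum_of_subset_of_nonneg (subset_univ _) (fun _ _ _ => sq_nonneg _)
  calc g u ^ 2 = |g u| ^ 2 := (sq_abs _).symm
    _ ≤ r ^ 2 := by gcongr
    _ ≤ (I.card : ℝ) * ∑ v ∈ I, P v u ^ 2 := by rw [hrI]; exact hcs
    _ ≤ (I.card : ℝ) * 1 := by gcongr
    _ = _ := mul_one _

lemma A_one (G : SimpleGraph V) [DecidableRel G.Adj] :
    G.adjMatrix ℝ *ᵥ (fun _ => (1 : ℝ)) = fun v => (G.degree v : ℝ) := by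
  ext v; simp [SimpleGraph.adjMatrix_mulVec_apply]

lemma A_deg (G : SimpleGraph V) [DecidableRel G.Adj] :
    G.adjMatrix ℝ *ᵥ (fun v => (G.degree v : ℝ)) = twoDeg G := by
  ext v; simp [SimpleGraph.adjMatrix_mulVec_apply, twoDeg]

lemma z_const {τ : ℝ} (h : EqP G (fun u => twoDeg G u - τ) s P) {u v w : V}
    (hu : G.Adj w u) (hv : G.Adj w v) :
    (P *ᵥ fun _ => (1 : ℝ)) u = (P *ᵥ fun _ => (1 : ℝ)) v := by
  set A := G.adjMatrix ℝ with hA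
  set z := P *ᵥ fun _ => (1 : ℝ) with hz
  have h1 : A *ᵥ (A *ᵥ z) = fun v => twoDeg G v * z v := by
    have hcm : ∀ x : V → ℝ, A *ᵥ (P *ᵥ x) = P *ᵥ (A *ᵥ x) := by
      intro x; rw [mulVec_mulVec, mulVec_mulVec, hA, h.comm]
    rw [hz, hcm, hcm, A_one, A_deg]
    ext v
    simp only [mulVec, dotProduct, Finset.mul_sum, mul_one]
    refine Finset.sum_congr rfl fun w _ => ?_
    by_cases h0 : P v w = 0
    · simp [h0]
    · have := h.supp_g v w h0
      have : twoDeg G v = twoDeg G w := by simpa using this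
      rw [this]; ring
  have h2 : ∑ w, (∑ u ∈ G.neighborFinset w, z u) ^ 2
      = ∑ w, ((G.neighborFinset w).card : ℝ) * ∑ u ∈ G.neighborFinset w, z u ^ 2 := by
    have e1 : (A *ᵥ z) ⬝ᵥ (A *ᵥ z) = ∑ w, (∑ u ∈ G.neighborFinset w, z u) ^ 2 := by
      simp only [dotProduct, hA, SimpleGraph.adjMatrix_mulVec_apply, pow_two]
    have e2 : (A *ᵥ z) ⬝ᵥ (A *ᵥ z) = (fun v => (G.degree v : ℝ)) ⬝ᵥ (A *ᵥ (fun u => z u ^ 2)) := by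
      rw [← dotA, ← hA, h1, hA, dotA, A_deg]
      simp only [dotProduct]
      refine Finset.sum_congr rfl fun w _ => ?_
      ring
    rw [← e1, e2]
    simp only [dotProduct, hA, SimpleGraph.adjMatrix_mulVec_apply, SimpleGraph.card_neighborFinset_eq_degree]
  have h3 := (Finset.sum_eq_sum_iff_of_le (fun w _ =>
    sq_sum_le_card_mul_sum_sq (s := G.neighborFinset w) (f := z))).1 h2 w (mem_univ w)
  exact const_of_cs (G.neighborFinset w) z h3.ge (by simpa using hu) (by simpa using hv)

end EqP

namespace EqP

variable {G : SimpleGraph V} [DecidableRel G.Adj] {s : V → ℝ} {P : Matrix V V ℝ}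

lemma s_ne {g : V → ℝ} (h : EqP G g s P) (u : V) : - s u ≠ s u := by
  rcases h.hs u with h1 | h1 <;> rw [h1] <;> norm_num

lemma exists_nbr {g : V → ℝ} (h : EqP G g s P) {u : V} (hu : g u ≠ 0) : ∃ v, G.Adj u v := by
  have h1 := h.inner_deg hu
  have h2 : 0 < g u ^ 2 := by positivity
  have h3 : 0 < ((G.neighborFinset u).filter fun v => g v = g u).card := by
    exact_mod_cast lt_of_lt_of_le h2 h1
  obtain ⟨v, hv⟩ := Finset.card_pos.1 h3
  exact ⟨v, by simpa using (Finset.mem_filter.1 hv).1⟩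

open Classical in
lemma good {τ : ℝ} (h : EqP G (fun u => twoDeg G u - τ) s P) {u0 : V}
    (hu0 : twoDeg G u0 - τ ≠ 0) (χ : V → ℝ) (hχ1 : ∀ w, G.Reachable u0 w → χ w = 1)
    (hχ0 : ∀ w, ¬ G.Reachable u0 w → χ w = 0) : P *ᵥ χ = χ := by
  set g : V → ℝ := fun u => twoDeg G u - τ with hg
  change g u0 ≠ 0 at hu0
  set z := P *ᵥ fun _ => (1 : ℝ) with hz
  have hzs : ∀ u, z u = ∑ w, P u w := by intro u; simp [hz, mulVec, dotProduct]
  obtain ⟨v0, hv0⟩ := h.exists_nbr hu0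
  have hval : ∀ w, G.Reachable u0 w → (z w = if s w = s u0 then z u0 else z v0) ∧
      ∀ w', G.Adj w w' → z w' = if s w' = s u0 then z u0 else z v0 := by
    intro w hw
    rw [SimpleGraph.reachable_iff_reflTransGen] at hw
    induction hw with
    | refl =>
      refine ⟨by simp, fun w' hw' => ?_⟩
      have h1 := h.adj_s _ _ hw'
      have h2 : s w' ≠ s u0 := by rw [h1]; exact (h.s_ne w').symm
      rw [if_neg h2]
      exact h.z_const hw' hv0
    | tail _ hbc ih =>
      rename_i b c _
      refine ⟨ih.2 c hbc, fun w' hw' => ?_⟩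
      have h1 := h.adj_s _ _ hw'
      have h2 := h.adj_s _ _ hbc
      have h3 : s w' = s b := by rw [h2, h1, neg_neg]
      rw [h3, ← ih.1]
      exact h.z_const hw' hbc.symm
  have hχadj : ∀ u v, G.Adj u v → χ u = χ v := by
    intro u v huv
    by_cases hr : G.Reachable u0 u
    · rw [hχ1 u hr, hχ1 v (hr.trans huv.reachable)]
    · have : ¬ G.Reachable u0 v := fun hv => hr (hv.trans huv.symm.reachable)
      rw [hχ0 u hr, hχ0 v this]
  have hPr : ∀ u v, P u v ≠ 0 → G.Reachable u0 u → G.Reachable u0 v := by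
    intro u v huv hu
    have h1 := h.fcomm χ hχadj u v huv
    by_contra hv
    rw [hχ1 u hu, hχ0 v hv] at h1
    norm_num at h1
  set X := univ.filter (fun w => G.Reachable u0 w ∧ g w = g u0 ∧ s w = s u0) with hX
  set Y := univ.filter (fun w => G.Reachable u0 w ∧ g w = g u0 ∧ s w = - s u0) with hY
  have hXY : ∀ v w, P v w ≠ 0 → v ∈ X → w ∈ Y := by
    intro v w hvw hv
    rw [hX, Finset.mem_filter] at hv
    rw [hY, Finset.mem_filter]
    obtain ⟨-, a, b, c⟩ := hv
    refine ⟨mem_univ _, hPr v w hvw a, ?_, ?_⟩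
    · rw [← h.supp_g v w hvw, b]
    · rw [← c, h.supp_s v w hvw, neg_neg]
  have hYX : ∀ v w, P v w ≠ 0 → v ∈ Y → w ∈ X := by
    intro v w hvw hv
    rw [hY, Finset.mem_filter] at hv
    rw [hX, Finset.mem_filter]
    obtain ⟨-, a, b, c⟩ := hv
    refine ⟨mem_univ _, hPr v w hvw a, ?_, ?_⟩
    · rw [← h.supp_g v w hvw, b]
    · have := h.supp_s v w hvw
      linarith
  have hu0X : u0 ∈ X := by
    rw [hX, Finset.mem_filter]; exact ⟨mem_univ _, SimpleGraph.Reachable.refl u0, rfl, rfl⟩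
  have hgX : ∀ v ∈ X, g v ≠ 0 := by
    intro v hv
    rw [hX, Finset.mem_filter] at hv
    rw [hv.2.2.1]; exact hu0
  have hgY : ∀ v ∈ Y, g v ≠ 0 := by
    intro v hv
    rw [hY, Finset.mem_filter] at hv
    rw [hv.2.2.1]; exact hu0
  have hzX : ∀ v ∈ X, z v = z u0 := by
    intro v hv
    rw [hX, Finset.mem_filter] at hv
    rw [(hval v hv.2.1).1, if_pos hv.2.2.2]
  have hzY : ∀ v ∈ Y, z v = z v0 := by
    intro v hv
    rw [hY, Finset.mem_filter] at hv
    rw [(hval v hv.2.1).1, if_neg]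
    rw [hv.2.2.2]; exact h.s_ne u0
  have hsX : ∀ (f : ℝ → ℝ) (_ : f 0 = 0), ∀ v ∈ X, ∑ w, f (P v w) = ∑ w ∈ Y, f (P v w) := by
    intro f hf v hv
    refine (Finset.sum_subset (subset_univ _) fun w _ hw => ?_).symm
    have : P v w = 0 := by
      by_contra h0; exact hw (hXY v w h0 hv)
    rw [this, hf]
  have hsY : ∀ (f : ℝ → ℝ) (_ : f 0 = 0), ∀ v ∈ Y, ∑ w, f (P v w) = ∑ w ∈ X, f (P v w) := by
    intro f hf v hv
    refine (Finset.sum_subset (subset_univ _) fun w _ hw => ?_).symm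
    have : P v w = 0 := by
      by_contra h0; exact hw (hYX v w h0 hv)
    rw [this, hf]
  have hcomm : ∀ f : ℝ → ℝ, f 0 = 0 → ∑ v ∈ X, ∑ w, f (P v w) = ∑ w ∈ Y, ∑ v, f (P w v) := by
    intro f hf
    rw [Finset.sum_congr rfl (hsX f hf), Finset.sum_congr rfl (hsY f hf), Finset.sum_comm]
    refine Finset.sum_congr rfl fun w _ => Finset.sum_congr rfl fun v _ => ?_
    rw [h.symm]
  have hrow : ∀ v, g v ≠ 0 → ∑ w, (P v w) ^ 2 = 1 := by
    intro v hv
    rw [← h.row_sq hv]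
    exact Finset.sum_congr rfl fun w _ => by rw [h.symm]
  have hcard : (X.card : ℝ) = Y.card := by
    have := hcomm (fun x => x ^ 2) (by norm_num)
    rw [Finset.sum_congr rfl (fun v hv => hrow v (hgX v hv)),
      Finset.sum_congr rfl (fun v hv => hrow v (hgY v hv))] at this
    simpa using this
  have hXpos : (0 : ℝ) < X.card := by exact_mod_cast Finset.card_pos.2 ⟨u0, hu0X⟩
  have hαβ : z u0 = z v0 := by
    have := hcomm (fun x => x) rfl
    simp only [← hzs] at this
    rw [Finset.sum_congr rfl hzX, Finset.sum_congr rfl hzY] at this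
    simp only [Finset.sum_const, nsmul_eq_mul, ← hcard] at this
    exact mul_left_cancel₀ hXpos.ne' this
  have hprod : z u0 * z v0 = 1 := by
    have h1 : ∑ v, ∑ w, P u0 w * P w v = 1 := by
      simp only [h.sq u0 _ hu0]; simp
    rw [Finset.sum_comm] at h1
    simp only [← Finset.mul_sum, ← hzs] at h1
    rw [← h1, hzs u0, Finset.sum_mul]
    refine Finset.sum_congr rfl fun w _ => ?_
    by_cases h0 : P u0 w = 0
    · simp [h0]
    · rw [hzY w (hXY u0 w h0 hu0X)]
  have hPχ : P *ᵥ χ = z u0 • χ := by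
    ext v
    have h1 : (P *ᵥ χ) v = χ v * z v := by
      rw [hzs, Finset.mul_sum]
      simp only [mulVec, dotProduct]
      refine Finset.sum_congr rfl fun w _ => ?_
      by_cases h0 : P v w = 0
      · simp [h0]
      · rw [h.fcomm χ hχadj v w h0]; ring
    rw [h1]
    by_cases hv : G.Reachable u0 v
    · rw [(hval v hv).1, ← hαβ]; simp [mul_comm]
    · simp [hχ0 v hv]
  have hpos : 0 ≤ z u0 * ∑ v, χ v * ∑ w ∈ G.neighborFinset v, χ w := by
    have h1 := h.hR.dotProduct_mulVec_nonneg χ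
    rw [star_trivial, ← mulVec_mulVec, h.dotP, hPχ, smul_dotProduct] at h1
    simpa only [dotProduct, SimpleGraph.adjMatrix_mulVec_apply, smul_eq_mul] using h1
  have hχn : ∀ v, 0 ≤ χ v := by
    intro v
    by_cases hv : G.Reachable u0 v
    · rw [hχ1 v hv]; norm_num
    · rw [hχ0 v hv]
  have hpos2 : 0 < ∑ v, χ v * ∑ w ∈ G.neighborFinset v, χ w := by
    refine Finset.sum_pos' (fun v _ => mul_nonneg (hχn v) (Finset.sum_nonneg fun w _ => hχn w)) ⟨u0, mem_univ _, ?_⟩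
    rw [hχ1 u0 (SimpleGraph.Reachable.refl u0), one_mul]
    refine Finset.sum_pos' (fun w _ => hχn w) ⟨v0, by simpa using hv0, ?_⟩
    rw [hχ1 v0 hv0.reachable]; norm_num
  have hα0 : 0 ≤ z u0 := nonneg_of_mul_nonneg_left hpos hpos2
  have hα : z u0 = 1 := by
    rw [← hαβ] at hprod
    nlinarith
  rw [hPχ, hα, one_smul]

end EqP

lemma exists_k {τ : ℝ} (hτ : 0 < τ) : ∃ k : ℕ, 1 ≤ k ∧ (k : ℝ) ^ 2 - k < τ ∧ τ ≤ (k : ℝ) ^ 2 + k := by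
  classical
  have hex : ∃ k : ℕ, τ ≤ (k : ℝ) ^ 2 + k := by
    obtain ⟨n, hn⟩ := exists_nat_ge τ
    exact ⟨n, by nlinarith [sq_nonneg (n : ℝ)]⟩
  have h1 := Nat.find_spec hex
  have h0 : Nat.find hex ≠ 0 := by
    intro h0
    rw [h0] at h1; norm_num at h1; linarith
  have h2 := Nat.find_min hex (m := Nat.find hex - 1) (by omega)
  refine ⟨Nat.find hex, by omega, ?_, h1⟩
  push Not at h2
  rw [Nat.cast_sub (by omega)] at h2
  push_cast at h2
  nlinarith

lemma int_q (h : ℤ) : 0 ≤ (h : ℝ) * (h - 1) ∧ 0 ≤ (h : ℝ) * (h + 1) := by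
  have h1 : 0 ≤ h * (h - 1) := by
    rcases le_or_gt h 0 with h0 | h0 <;> nlinarith
  have h2 : 0 ≤ h * (h + 1) := by
    rcases lt_or_ge h 0 with h0 | h0 <;> nlinarith
  exact ⟨by exact_mod_cast h1, by exact_mod_cast h2⟩

namespace EqP

variable {G : SimpleGraph V} [DecidableRel G.Adj] {s : V → ℝ} {P : Matrix V V ℝ}

lemma g_bound {τ : ℝ} (h : EqP G (fun u => twoDeg G u - τ) s P) {k : ℕ} (hk : 1 ≤ k)
    (hk2 : τ ≤ (k : ℝ) ^ 2 + k) (v : V) :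
    |twoDeg G v - τ| ≤ k ∧ (k = 1 ∨ |twoDeg G v - τ| < k) := by
  set g : V → ℝ := fun u => twoDeg G u - τ with hg
  change |g v| ≤ k ∧ (k = 1 ∨ |g v| < k)
  have hk' : (1 : ℝ) ≤ k := by exact_mod_cast hk
  by_cases ha : |g v| ≤ 1
  · refine ⟨by linarith, ?_⟩
    rcases Nat.eq_or_lt_of_le hk with h1 | h1
    · left; exact h1.symm
    · right
      have : (2 : ℝ) ≤ k := by exact_mod_cast h1
      linarith
  push Not at ha
  suffices hlt : |g v| < k from ⟨hlt.le, Or.inr hlt⟩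
  have hgv : g v ≠ 0 := by
    intro h0; rw [h0] at ha; norm_num at ha
  set a := |g v| with hadef
  have ha2 : a ^ 2 = g v ^ 2 := sq_abs _
  set I := (G.neighborFinset v).filter fun w => g w = g v with hI
  have hIc : a ^ 2 ≤ (I.card : ℝ) := by rw [ha2]; exact h.inner_deg hgv
  have hIc2 : (2 : ℝ) ≤ I.card := by
    have : (1 : ℝ) < I.card := by nlinarith
    have : 1 < I.card := by exact_mod_cast this
    exact_mod_cast this
  have hdw : ∀ w ∈ I, a ^ 2 ≤ (G.degree w : ℝ) ∧ (2 : ℝ) ≤ G.degree w := by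
    intro w hw
    have hgw : g w = g v := (Finset.mem_filter.1 hw).2
    have h1 := h.inner_deg (u := w) (by rw [hgw]; exact hgv)
    have h2 : (((G.neighborFinset w).filter fun x => g x = g w).card : ℝ) ≤ G.degree w := by
      rw [← SimpleGraph.card_neighborFinset_eq_degree]
      exact_mod_cast Finset.card_filter_le _ _
    have h3 : a ^ 2 ≤ (G.degree w : ℝ) := by
      rw [ha2, ← hgw]; exact h1.trans h2
    refine ⟨h3, ?_⟩
    have : (1 : ℝ) < G.degree w := by nlinarith
    have : 1 < G.degree w := by exact_mod_cast this
    exact_mod_cast this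
  have htI : ∑ w ∈ I, (G.degree w : ℝ) ≤ twoDeg G v := by
    rw [twoDeg]
    exact Finset.sum_le_sum_of_subset_of_nonneg (Finset.filter_subset _ _)
      (fun _ _ _ => Nat.cast_nonneg _)
  have ht1 : (I.card : ℝ) * a ^ 2 ≤ twoDeg G v := by
    refine le_trans ?_ htI
    rw [← nsmul_eq_mul]
    exact Finset.card_nsmul_le_sum _ _ _ (fun w hw => (hdw w hw).1)
  have ht2 : (I.card : ℝ) * 2 ≤ twoDeg G v := by
    refine le_trans ?_ htI
    rw [← nsmul_eq_mul]
    exact Finset.card_nsmul_le_sum _ _ _ (fun w hw => (hdw w hw).2)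
  have hga : g v ≤ a := le_abs_self _
  have hgτ : τ = twoDeg G v - g v := by simp [hg]
  have h4 : 4 - a ≤ τ := by linarith
  have h5 : a ^ 2 * a ^ 2 - a ≤ τ := by nlinarith [sq_nonneg a]
  by_contra hcon
  push Not at hcon
  have h6 : (k : ℝ) ^ 2 + k ≤ a ^ 2 + a := by nlinarith
  have h7 : a ^ 3 ≤ a + 2 := by
    have : a * a ^ 3 ≤ a * (a + 2) := by nlinarith
    exact le_of_mul_le_mul_left this (by linarith)
  have h8 : a < 1.6 := by
    by_contra h9
    push Not at h9
    nlinarith [mul_nonneg (sub_nonneg.2 h9) (sub_nonneg.2 h9), sq_nonneg a]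
  have h9 : k < 2 := by
    have : (k : ℝ) < 2 := by linarith
    exact_mod_cast this
  have h10 : k = 1 := by omega
  rw [h10] at hk2
  norm_num at hk2
  linarith

open Classical in
lemma regular {τ : ℝ} (hτ : 0 < τ) (h : EqP G (fun u => twoDeg G u - τ) s P) {u0 : V}
    (hu0 : twoDeg G u0 - τ ≠ 0) : ∀ w, G.Reachable u0 w → G.degree w = G.degree u0 := by
  set χ : V → ℝ := fun w => if G.Reachable u0 w then 1 else 0 with hχ
  have hχ1 : ∀ w, G.Reachable u0 w → χ w = 1 := fun w hw => by simp [hχ, hw]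
  have hχ0 : ∀ w, ¬ G.Reachable u0 w → χ w = 0 := fun w hw => by simp [hχ, hw]
  have hPχ := h.good hu0 χ hχ1 hχ0
  have hχadj : ∀ u v, G.Adj u v → χ u = χ v := by
    intro u v huv
    by_cases hr : G.Reachable u0 u
    · rw [hχ1 u hr, hχ1 v (hr.trans huv.reachable)]
    · have : ¬ G.Reachable u0 v := fun hv => hr (hv.trans huv.symm.reachable)
      rw [hχ0 u hr, hχ0 v this]
  set g : V → ℝ := fun u => twoDeg G u - τ with hg
  change g u0 ≠ 0 at hu0
  set A := G.adjMatrix ℝ with hA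
  set d : V → ℝ := fun v => (G.degree v : ℝ) with hd
  have hloc : ∀ f : V → ℝ, A *ᵥ (fun v => χ v * f v) = fun v => χ v * (A *ᵥ f) v := by
    intro f; ext v
    rw [hA, SimpleGraph.adjMatrix_mulVec_apply, SimpleGraph.adjMatrix_mulVec_apply, Finset.mul_sum]
    refine Finset.sum_congr rfl fun w hw => ?_
    rw [hχadj v w (by simpa using hw)]
  have hAχ : A *ᵥ χ = fun v => χ v * d v := by
    have := hloc (fun _ => 1)
    rw [hA, A_one, ← hA] at this
    simpa using this
  have hPχd : P *ᵥ (fun v => χ v * d v) = fun v => χ v * d v := by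
    rw [← hAχ, mulVec_mulVec, hA, h.comm, ← mulVec_mulVec, hPχ]
  set H : ℝ → V → ℝ := fun k v => χ v * (d v - k) with hH
  have hHsplit : ∀ k, H k = (fun v => χ v * d v) - k • χ := by
    intro k; ext v; simp [hH]; ring
  have hPH : ∀ k, P *ᵥ (H k) = H k := by
    intro k
    rw [hHsplit, mulVec_sub, mulVec_smul, hPχ, hPχd]
  have hAH : ∀ k, A *ᵥ (H k) = fun v => χ v * (twoDeg G v - k * d v) := by
    intro k
    rw [hHsplit, mulVec_sub, mulVec_smul, hAχ, hloc, hA, A_deg]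
    ext v; simp; ring
  set C := univ.filter (fun w => G.Reachable u0 w) with hC
  have hsumC : ∀ f : V → ℝ, ∑ v, χ v * f v = ∑ v ∈ C, f v := by
    intro f
    rw [hC, Finset.sum_filter]
    refine Finset.sum_congr rfl fun v _ => ?_
    simp only [hχ]; split_ifs <;> simp
  have hχsq : ∀ v, χ v * χ v = χ v := by
    intro v; simp only [hχ]; split_ifs <;> simp
  have hHA : ∀ k, H k ⬝ᵥ (A *ᵥ H k) = ∑ v ∈ C, (d v - k) * (twoDeg G v - k * d v) := by
    intro k
    rw [hAH, ← hsumC]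
    simp only [dotProduct, hH]
    refine Finset.sum_congr rfl fun v _ => ?_
    linear_combination (d v - k) * (twoDeg G v - k * d v) * hχsq v
  have hHD : ∀ k, H k ⬝ᵥ (fun v => g v * H k v) = ∑ v ∈ C, g v * (d v - k) ^ 2 := by
    intro k
    rw [← hsumC]
    simp only [dotProduct, hH]
    refine Finset.sum_congr rfl fun v _ => ?_
    linear_combination g v * (d v - k) ^ 2 * hχsq v
  have hs2 : ∀ v, s v * s v = 1 := by
    intro v; rcases h.hs v with h1 | h1 <;> rw [h1] <;> norm_num
  have I1 : ∀ k, 0 ≤ ∑ v ∈ C, ((d v - k) * (twoDeg G v - k * d v) - g v * (d v - k) ^ 2) := by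
    intro k
    have := h.qf_nonneg (H k)
    rw [hPH, ← hA, hHA, hHD] at this
    rwa [Finset.sum_sub_distrib]
  have I2 : ∀ k, 0 ≤ ∑ v ∈ C, ((d v - k) * (twoDeg G v - k * d v) + g v * (d v - k) ^ 2) := by
    intro k
    have h1 := h.qf_nonneg (fun v => s v * H k v)
    have h2 : P *ᵥ (fun v => s v * H k v) = fun v => - (s v * H k v) := by
      ext v
      rw [← congrFun (hPH k) v]
      simp only [mulVec, dotProduct, Finset.mul_sum, ← Finset.sum_neg_distrib]
      refine Finset.sum_congr rfl fun w _ => ?_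
      by_cases h0 : P v w = 0
      · simp [h0]
      · rw [h.supp_s v w h0]; ring
    have h3 : A *ᵥ (fun v => s v * H k v) = fun v => - (s v * (A *ᵥ H k) v) := by
      ext v
      rw [hA, SimpleGraph.adjMatrix_mulVec_apply, SimpleGraph.adjMatrix_mulVec_apply,
        Finset.mul_sum, ← Finset.sum_neg_distrib]
      refine Finset.sum_congr rfl fun w hw => ?_
      rw [h.adj_s v w (by simpa using hw)]; ring
    rw [h2, ← hA, h3] at h1
    have h4 : (fun v => - (s v * H k v)) ⬝ᵥ (fun v => - (s v * (A *ᵥ H k) v)) = H k ⬝ᵥ (A *ᵥ H k) := by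
      simp only [dotProduct]
      refine Finset.sum_congr rfl fun v _ => ?_
      linear_combination H k v * (A *ᵥ H k) v * hs2 v
    have h5 : (fun v => - (s v * H k v)) ⬝ᵥ (fun v => g v * (s v * H k v))
        = - (H k ⬝ᵥ (fun v => g v * H k v)) := by
      simp only [dotProduct, ← Finset.sum_neg_distrib]
      refine Finset.sum_congr rfl fun v _ => ?_
      linear_combination - H k v * g v * H k v * hs2 v
    rw [h4, h5, hHA, hHD] at h1
    rw [Finset.sum_add_distrib]; linarith
  have I1z : ∀ k, ∑ v ∈ C, ((d v - k) * (twoDeg G v - k * d v) - g v * (d v - k) ^ 2) = 0 →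
      ∀ v, (A *ᵥ H k) v = g v * H k v := by
    intro k hz v
    have h1 : star (H k) ⬝ᵥ ((P * A - P * diagonal g) *ᵥ (H k)) = 0 := by
      rw [star_trivial, hA, h.qf, hPH, ← hA, hHA, hHD, ← Finset.sum_sub_distrib, hz]
    rw [h.psd.dotProduct_mulVec_zero_iff, sub_mulVec, h.comm, ← mulVec_mulVec,
      hPH, ← mulVec_mulVec] at h1
    have h2 := congrFun h1 v
    have h3 : (P *ᵥ (diagonal g *ᵥ H k)) v = g v * (P *ᵥ H k) v := by
      have hdg : diagonal g *ᵥ H k = fun w => g w * H k w := by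
        ext w; rw [mulVec_diagonal]
      rw [hdg]
      simp only [mulVec, dotProduct, Finset.mul_sum]
      refine Finset.sum_congr rfl fun w _ => ?_
      by_cases h0 : P v w = 0
      · simp [h0]
      · rw [h.supp_g v w h0]; ring
    rw [Pi.sub_apply, h3, hPH] at h2
    simp only [Pi.zero_apply] at h2
    linarith
  have hedge : ∀ v w, G.Reachable u0 v → G.Adj v w → G.degree v = G.degree w := by
    obtain ⟨k, hk1, hkl, hku⟩ := exists_k hτ
    have hC' : ∀ v, G.Reachable u0 v → v ∈ C := fun v hv => by simp [hC, hv]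
    have hint : ∀ v, (d v - k) = ((G.degree v : ℤ) - k : ℤ) := by
      intro v; simp [hd]
    have hq : ∀ v, 0 ≤ (d v - k) * (d v - k - 1) ∧ 0 ≤ (d v - k) * (d v - k + 1) := by
      intro v; rw [hint v]; exact int_q _
    have htg : ∀ v, twoDeg G v = τ + g v := by intro v; simp [hg]
    have hI1 : 0 ≤ (τ - k ^ 2 - k) * ∑ v ∈ C, (d v - k)
        - ∑ v ∈ C, (k + g v) * ((d v - k) * (d v - k - 1)) := by
      have := I1 k
      rw [Finset.mul_sum, ← Finset.sum_sub_distrib]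
      convert this using 2 with v hv
      rw [htg]; ring
    have hI2 : 0 ≤ (τ - k ^ 2 + k) * ∑ v ∈ C, (d v - k)
        - ∑ v ∈ C, (k - g v) * ((d v - k) * (d v - k + 1)) := by
      have := I2 k
      rw [Finset.mul_sum, ← Finset.sum_sub_distrib]
      convert this using 2 with v hv
      rw [htg]; ring
    have hI3 : 0 ≤ (τ - k ^ 2 - k) * ∑ v ∈ C, (d v - k - 1)
        - ∑ v ∈ C, (k + 1 - g v) * ((d v - k) * (d v - k - 1)) := by
      have := I2 (k + 1)
      rw [Finset.mul_sum, ← Finset.sum_sub_distrib]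
      convert this using 2 with v hv
      rw [htg]; ring
    rcases eq_or_lt_of_le hku with heq | hlt
    · -- boundary case
      have h0 : τ - (k : ℝ) ^ 2 - k = 0 := by linarith
      rw [h0, zero_mul] at hI1 hI3
      have h1 : ∑ v ∈ C, (2 * (k : ℝ) + 1) * ((d v - k) * (d v - k - 1)) ≤ 0 := by
        have : ∑ v ∈ C, (2 * (k : ℝ) + 1) * ((d v - k) * (d v - k - 1))
          = ∑ v ∈ C, (k + g v) * ((d v - k) * (d v - k - 1))
            + ∑ v ∈ C, (k + 1 - g v) * ((d v - k) * (d v - k - 1)) := by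
          rw [← Finset.sum_add_distrib]
          exact Finset.sum_congr rfl fun v _ => by ring
        rw [this]; linarith
      have hnn : ∀ v ∈ C, 0 ≤ (2 * (k : ℝ) + 1) * ((d v - k) * (d v - k - 1)) :=
        fun v _ => mul_nonneg (by positivity) (hq v).1
      have h2 := (Finset.sum_eq_zero_iff_of_nonneg hnn).1 (le_antisymm h1 (Finset.sum_nonneg hnn))
      have h3 : ∀ v ∈ C, (d v - k) * (d v - k - 1) = 0 := by
        intro v hv
        rcases mul_eq_zero.1 (h2 v hv) with h4 | h4
        · exfalso; have : (0 : ℝ) ≤ k := Nat.cast_nonneg _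
          linarith
        · exact h4
      have h4 : ∑ v ∈ C, ((d v - k) * (twoDeg G v - k * d v) - g v * (d v - k) ^ 2) = 0 := by
        refine Finset.sum_eq_zero fun v hv => ?_
        rw [htg]
        linear_combination (d v - k) * h0 - (k + g v) * h3 v hv
      have h5 := I1z k h4
      have hHn : ∀ w, 0 ≤ H k w := by
        intro w
        by_cases hw : G.Reachable u0 w
        · simp only [hH, hχ1 w hw, one_mul]
          rcases mul_eq_zero.1 (h3 w (hC' w hw)) with h6 | h6 <;> linarith
        · simp [hH, hχ0 w hw]
      have h6 : ∀ v w, G.Reachable u0 v → G.Adj v w → d v - k = 0 → d w - k = 0 := by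
        intro v w hv hvw hd0
        have h7 := h5 v
        have h8 : H k v = 0 := by simp [hH, hd0]
        rw [h8, mul_zero, hA, SimpleGraph.adjMatrix_mulVec_apply,
          Finset.sum_eq_zero_iff_of_nonneg (fun w _ => hHn w)] at h7
        have h9 := h7 w (by simpa using hvw)
        simpa [hH, hχ1 w (hv.trans hvw.reachable)] using h9
      intro v w hv hvw
      have hw := hv.trans hvw.reachable
      have : d v = d w := by
        rcases mul_eq_zero.1 (h3 v (hC' v hv)) with a | a
        · have := h6 v w hv hvw a
          linarith
        · rcases mul_eq_zero.1 (h3 w (hC' w hw)) with b | b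
          · have := h6 w v hw hvw.symm b
            linarith
          · linarith
      exact_mod_cast (show (G.degree v : ℝ) = G.degree w from this)
    · have hb := fun v => h.g_bound hk1 hku v
      have hb1 : ∀ v, 0 ≤ (k : ℝ) + g v ∧ 0 ≤ (k : ℝ) - g v := by
        intro v
        have := abs_le.1 (hb v).1
        constructor
        · have := this.1; simp only [hg]; linarith
        · have := this.2; simp only [hg]; linarith
      have hn1 : ∀ v ∈ C, 0 ≤ (k + g v) * ((d v - k) * (d v - k - 1)) :=
        fun v _ => mul_nonneg (hb1 v).1 (hq v).1
      have hn2 : ∀ v ∈ C, 0 ≤ (k - g v) * ((d v - k) * (d v - k + 1)) :=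
        fun v _ => mul_nonneg (hb1 v).2 (hq v).2
      have hS1 := Finset.sum_nonneg hn1
      have hS2 := Finset.sum_nonneg hn2
      have hsum0 : ∑ v ∈ C, (d v - k) = 0 := by
        apply le_antisymm
        · by_contra hc
          push Not at hc
          nlinarith
        · by_contra hc
          push Not at hc
          nlinarith
      rw [hsum0, mul_zero] at hI1 hI2
      have e1 := (Finset.sum_eq_zero_iff_of_nonneg hn1).1 (by linarith)
      have e2 := (Finset.sum_eq_zero_iff_of_nonneg hn2).1 (by linarith)
      have hall : ∀ v ∈ C, d v - k = 0 := by
        by_cases hk : k = 1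
        · have hdpos : ∀ v ∈ C, 0 ≤ d v - k := by
            intro v hv
            have hv' : G.Reachable u0 v := by simpa [hC] using hv
            have hex : ∃ w, G.Adj v w := by
              rw [SimpleGraph.reachable_iff_reflTransGen] at hv'
              cases hv' with
              | refl => exact h.exists_nbr hu0
              | tail _ hbc => exact ⟨_, hbc.symm⟩
            have h1 : 0 < G.degree v := (G.degree_pos_iff_exists_adj v).2 hex
            have h2 : (1 : ℝ) ≤ G.degree v := by exact_mod_cast h1
            rw [hk]; simp only [hd]; push_cast; linarith
          exact (Finset.sum_eq_zero_iff_of_nonneg hdpos).1 hsum0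
        · intro v hv
          have hlt := abs_lt.1 ((hb v).2.resolve_left hk)
          have p1 : (k : ℝ) + g v ≠ 0 := by
            have := hlt.1; simp only [hg]; intro hh; linarith
          have p2 : (k : ℝ) - g v ≠ 0 := by
            have := hlt.2; simp only [hg]; intro hh; linarith
          have q1 := (mul_eq_zero.1 (e1 v hv)).resolve_left p1
          have q2 := (mul_eq_zero.1 (e2 v hv)).resolve_left p2
          linarith
      intro v w hv hvw
      have a := hall v (hC' v hv)
      have b := hall w (hC' w (hv.trans hvw.reachable))
      have : d v = d w := by linarith
      exact_mod_cast (show (G.degree v : ℝ) = G.degree w from this)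
  intro w hw
  have hw' := hw
  rw [SimpleGraph.reachable_iff_reflTransGen] at hw'
  clear hw
  induction hw' with
  | refl => rfl
  | tail hab hbc ih =>
    rw [← ih]
    exact (hedge _ _ ((SimpleGraph.reachable_iff_reflTransGen _ _).2 hab) hbc).symm

end EqP

lemma final_arith {m n : ℕ} {τ : ℝ} (h1 : 0 < (m : ℝ) ^ 2 - τ) (h2 : (n : ℝ) ^ 2 - τ < 0)
    (h3 : ((m : ℝ) ^ 2 - τ) ^ 2 ≤ m) (h4 : ((n : ℝ) ^ 2 - τ) ^ 2 ≤ n) : False := by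
  have hn : (1 : ℝ) ≤ n := by
    have h5 : (0 : ℝ) < n := lt_of_lt_of_le (by nlinarith) h4
    have h6 : 0 < n := by exact_mod_cast h5
    exact_mod_cast h6
  have hmn : (n : ℝ) + 1 ≤ m := by
    have h5 : (n : ℝ) ^ 2 < (m : ℝ) ^ 2 := by linarith
    have h6 : (n : ℝ) < m := lt_of_pow_lt_pow_left₀ 2 (Nat.cast_nonneg _) h5
    have h7 : n < m := by exact_mod_cast h6
    exact_mod_cast h7
  have ha : (m : ℝ) ^ 2 - τ < m := by
    by_contra hc
    push Not at hc
    nlinarith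
  have hb : τ - (n : ℝ) ^ 2 ≤ n := by
    by_contra hc
    push Not at hc
    nlinarith
  nlinarith

lemma EqP.nonzero_deg {G : SimpleGraph V} [DecidableRel G.Adj] {s : V → ℝ} {P : Matrix V V ℝ}
    {τ : ℝ} (hτ : 0 < τ) (h : EqP G (fun u => twoDeg G u - τ) s P) {x : V}
    (hx : twoDeg G x - τ ≠ 0) :
    twoDeg G x = (G.degree x : ℝ) ^ 2 ∧ (twoDeg G x - τ) ^ 2 ≤ G.degree x := by
  constructor
  · have h1 := h.regular hτ hx
    rw [twoDeg, Finset.sum_congr rfl (g := fun _ => (G.degree x : ℝ))]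
    · rw [Finset.sum_const, SimpleGraph.card_neighborFinset_eq_degree, nsmul_eq_mul]; ring
    · intro v hv
      rw [h1 v (SimpleGraph.Adj.reachable (by simpa using hv))]
  · refine (h.inner_deg hx).trans ?_
    rw [← SimpleGraph.card_neighborFinset_eq_degree]
    exact_mod_cast Finset.card_filter_le _ _

theorem graphEnergy_le_wLapEnergy_twoDeg (G : SimpleGraph V) [DecidableRel G.Adj]
    (hG : G.Colorable 2) :
    graphEnergy G ≤ wLapEnergy G (twoDeg G) ∧
    (wLapEnergy G (twoDeg G) = graphEnergy G ↔ ∀ u v : V, twoDeg G u = twoDeg G v) := by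
  obtain ⟨hle, hex⟩ := extract G hG (twoDeg G)
  refine ⟨hle, fun heq => ?_, fun hconst => ?_⟩
  · obtain ⟨s, P, h⟩ := hex heq
    set τ := avgWeight (twoDeg G) with hτdef
    suffices hz : ∀ u, twoDeg G u - τ = 0 by
      intro u v
      linarith [hz u, hz v]
    by_contra hcon
    push Not at hcon
    obtain ⟨u, hu⟩ := hcon
    have hcard : (0 : ℝ) < Fintype.card V := by
      exact_mod_cast Fintype.card_pos_iff.2 ⟨u⟩
    have hsumτ : ∑ v, twoDeg G v = Fintype.card V * τ := by
      rw [hτdef, avgWeight]; field_simp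
    have hnn : ∀ v ∈ (univ : Finset V), 0 ≤ twoDeg G v := fun v _ =>
      Finset.sum_nonneg fun _ _ => Nat.cast_nonneg _
    have hτ0 : 0 ≤ τ := by
      have := Finset.sum_nonneg hnn
      rw [hsumτ] at this
      exact nonneg_of_mul_nonneg_right this hcard
    have hτ : 0 < τ := by
      rcases hτ0.lt_or_eq with h0 | h0
      · exact h0
      · exfalso
        rw [← h0, mul_zero] at hsumτ
        have := (Finset.sum_eq_zero_iff_of_nonneg hnn).1 hsumτ u (mem_univ _)
        apply hu; rw [this, ← h0]; simp
    have hsum : ∑ v, (twoDeg G v - τ) = 0 := by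
      rw [Finset.sum_sub_distrib, hsumτ]; simp
    obtain ⟨p, -, hp⟩ := Finset.exists_pos_of_sum_zero_of_exists_nonzero _ hsum ⟨u, mem_univ _, hu⟩
    have hsum' : ∑ v, -(twoDeg G v - τ) = 0 := by
      rw [Finset.sum_neg_distrib, hsum, neg_zero]
    obtain ⟨q, -, hq⟩ := Finset.exists_pos_of_sum_zero_of_exists_nonzero _ hsum'
      ⟨u, mem_univ _, neg_ne_zero.2 hu⟩
    have hq' : twoDeg G q - τ < 0 := by linarith
    obtain ⟨a1, a2⟩ := h.nonzero_deg hτ hp.ne'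
    obtain ⟨b1, b2⟩ := h.nonzero_deg hτ hq'.ne
    rw [a1] at hp a2
    rw [b1] at hq' b2
    exact final_arith hp hq' a2 b2
  · refine le_antisymm ?_ hle
    have hav : ∀ u, twoDeg G u = avgWeight (twoDeg G) := by
      intro u
      have hcard : (Fintype.card V : ℝ) ≠ 0 := by
        exact_mod_cast (Fintype.card_pos_iff.2 ⟨u⟩).ne'
      rw [avgWeight, Finset.sum_congr rfl (fun v _ => hconst v u)]
      simp [hcard]
    have hN : -(G.adjMatrix ℝ) = wLaplacian G (twoDeg G)
        - avgWeight (twoDeg G) • (1 : Matrix V V ℝ) := by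
      have hd : diagonal (twoDeg G) = avgWeight (twoDeg G) • (1 : Matrix V V ℝ) := by
        ext i j
        by_cases hij : i = j
        · subst hij; simp [← hav i]
        · simp [hij]
      rw [wLaplacian, hd]; abel
    obtain ⟨P, hs, -, -, htr, -, hc, -⟩ :=
      exists_sgn (wLaplacian_isHermitian G (twoDeg G)) _ _ hN
    have := (trace_le_s7 (adjMatrix_isHermitian G) 0 (G.adjMatrix ℝ) (by simp) (-P)
      (by rw [transpose_neg, hs]) (by simpa using hc)).1
    rw [mul_neg, ← neg_mul] at htr
    rw [htr] at this
    simpa [graphEnergy, wLapEnergy] using this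
end

section
/- Let G be a bipartite simple graph on n vertices. Then max{ n·MD_t(G), E(G) } ≤ LE_t(G) ≤ n·MD_t(G) + E(G), where t is the 2-degree vertex weight. -/
open Matrix Finset

set_option linter.unusedSectionVars false

variable {V : Type*} [Fintype V] [DecidableEq V]

lemma spec_aux {H : Matrix V V ℝ} (hH : H.IsHermitian) (c : ℝ) :
    H - c • (1 : Matrix V V ℝ) = (hH.eigenvectorUnitary : Matrix V V ℝ) *
      diagonal (fun i => hH.eigenvalues i - c) * star (hH.eigenvectorUnitary : Matrix V V ℝ) := by
  have h1 := hH.spectral_theorem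
  rw [Unitary.conjStarAlgAut_apply] at h1
  have h2 : (hH.eigenvectorUnitary : Matrix V V ℝ) *
      star (hH.eigenvectorUnitary : Matrix V V ℝ) = 1 :=
    (Matrix.mem_unitaryGroup_iff).1 hH.eigenvectorUnitary.2
  have h3 : diagonal (fun i => hH.eigenvalues i - c) =
      diagonal (RCLike.ofReal ∘ hH.eigenvalues : V → ℝ) - c • (1 : Matrix V V ℝ) := by
    ext a b
    by_cases hab : a = b
    · subst hab; simp
    · simp [hab]
  rw [h3, mul_sub, sub_mul, ← h1, mul_smul_comm, mul_one, smul_mul_assoc, h2]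

lemma trace_mul_diag_le {Q : Matrix V V ℝ} (hQ : Q ∈ Matrix.unitaryGroup V ℝ) (d : V → ℝ) :
    |(Q * diagonal d).trace| ≤ ∑ i, |d i| := by
  simp only [Matrix.trace, Matrix.diag, Matrix.mul_diagonal]
  refine (Finset.abs_sum_le_sum_abs _ _).trans (Finset.sum_le_sum fun i _ => ?_)
  rw [abs_mul]
  have := entry_norm_bound_of_unitary hQ i i
  rw [Real.norm_eq_abs] at this
  nlinarith [abs_nonneg (d i)]

lemma trace_mul_le {H : Matrix V V ℝ} (hH : H.IsHermitian) (c : ℝ)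
    {Q : Matrix V V ℝ} (hQ : Q ∈ Matrix.unitaryGroup V ℝ) :
    |(Q * (H - c • (1 : Matrix V V ℝ))).trace| ≤ ∑ i, |hH.eigenvalues i - c| := by
  rw [spec_aux hH c, ← mul_assoc, Matrix.trace_mul_comm, ← mul_assoc, ← mul_assoc]
  refine trace_mul_diag_le ?_ _
  exact mul_mem (mul_mem (Unitary.star_mem hH.eigenvectorUnitary.2) hQ) hH.eigenvectorUnitary.2

lemma diag_mem_unitary {s : V → ℝ} (hs : ∀ i, s i * s i = 1) :
    diagonal s ∈ Matrix.unitaryGroup V ℝ := by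
  rw [Matrix.mem_unitaryGroup_iff, Matrix.star_eq_conjTranspose, Matrix.diagonal_conjTranspose,
    Matrix.diagonal_mul_diagonal]
  simp [hs]

lemma exists_sgn_s8 (d : V → ℝ) : ∃ s : V → ℝ, (∀ i, s i * s i = 1) ∧ ∀ i, s i * d i = |d i| := by
  refine ⟨fun i => if 0 ≤ d i then 1 else -1, fun i => ?_, fun i => ?_⟩
  · dsimp only; split_ifs <;> norm_num
  · dsimp only
    split_ifs with h
    · rw [abs_of_nonneg h, one_mul]
    · rw [abs_of_neg (not_le.1 h)]; ring

lemma exists_trace_eq {H : Matrix V V ℝ} (hH : H.IsHermitian) (c : ℝ) :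
    ∃ Q ∈ Matrix.unitaryGroup V ℝ,
      (Q * (H - c • (1 : Matrix V V ℝ))).trace = ∑ i, |hH.eigenvalues i - c| := by
  obtain ⟨s, hs, hd⟩ := exists_sgn_s8 (fun i => hH.eigenvalues i - c)
  have h2 : star (hH.eigenvectorUnitary : Matrix V V ℝ) *
      (hH.eigenvectorUnitary : Matrix V V ℝ) = 1 :=
    (Matrix.mem_unitaryGroup_iff').1 hH.eigenvectorUnitary.2
  refine ⟨(hH.eigenvectorUnitary : Matrix V V ℝ) * diagonal s *
    star (hH.eigenvectorUnitary : Matrix V V ℝ),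
    mul_mem (mul_mem hH.eigenvectorUnitary.2 (diag_mem_unitary hs))
      (Unitary.star_mem hH.eigenvectorUnitary.2), ?_⟩
  rw [spec_aux hH c]
  generalize (hH.eigenvectorUnitary : Matrix V V ℝ) = U at *
  have : U * diagonal s * star U * (U * diagonal (fun i => hH.eigenvalues i - c) * star U)
      = U * (diagonal s * diagonal (fun i => hH.eigenvalues i - c)) * star U := by
    calc _ = U * diagonal s * (star U * U) * diagonal (fun i => hH.eigenvalues i - c) * star U := by
          simp only [mul_assoc]
      _ = _ := by rw [h2]; simp only [mul_assoc, one_mul]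
  rw [this, Matrix.trace_mul_comm, ← mul_assoc, h2, one_mul, Matrix.diagonal_mul_diagonal,
    Matrix.trace_diagonal]
  exact Finset.sum_congr rfl fun i _ => hd i

lemma wLapEnergy_bounds (G : SimpleGraph V) [DecidableRel G.Adj]
    (hG : G.Colorable 2) (w : V → ℝ) :
    max ((Fintype.card V : ℝ) * meanDev w) (graphEnergy G) ≤ wLapEnergy G w ∧
    wLapEnergy G w ≤ (Fintype.card V : ℝ) * meanDev w + graphEnergy G := by
  have hmd : (Fintype.card V : ℝ) * meanDev w = ∑ v, |w v - avgWeight w| := by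
    unfold meanDev
    rcases isEmpty_or_nonempty V with h | h
    · simp
    · rw [mul_div_cancel₀]
      exact_mod_cast Fintype.card_ne_zero
  rw [hmd]
  unfold wLapEnergy
  set c := avgWeight w
  set D : Matrix V V ℝ := diagonal (fun v => w v - c) with hD
  set A : Matrix V V ℝ := G.adjMatrix ℝ with hA
  have hM : wLaplacian G w - c • (1 : Matrix V V ℝ) = D - A := by
    ext a b
    by_cases hab : a = b
    · subst hab; simp [wLaplacian, hD, hA]
    · simp [wLaplacian, hD, hA, hab]
  have hE : graphEnergy G = ∑ i, |(adjMatrix_isHermitian G).eigenvalues i - 0| := by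
    simp [graphEnergy]
  have hup : ∀ Q ∈ Matrix.unitaryGroup V ℝ, |(Q * (D - A)).trace| ≤
      ∑ i, |(wLaplacian_isHermitian G w).eigenvalues i - c| := by
    intro Q hQ
    rw [← hM]
    exact trace_mul_le (wLaplacian_isHermitian G w) c hQ
  have hupA : ∀ Q ∈ Matrix.unitaryGroup V ℝ, |(Q * A).trace| ≤ graphEnergy G := by
    intro Q hQ
    have := trace_mul_le (adjMatrix_isHermitian G) 0 hQ
    rwa [zero_smul, sub_zero, ← hE] at this
  refine ⟨max_le ?_ ?_, ?_⟩
  · obtain ⟨s, hs, hd⟩ := exists_sgn_s8 (fun v => w v - c)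
    have h := hup _ (diag_mem_unitary hs)
    have h2 : (diagonal s * (D - A)).trace = ∑ v, |w v - c| := by
      simp only [Matrix.trace, Matrix.diag, Matrix.diagonal_mul]
      refine Finset.sum_congr rfl fun i _ => ?_
      simp [hD, hA, ← hd]
    rw [h2] at h
    exact (le_abs_self _).trans h
  · obtain ⟨C⟩ := hG
    set p : V → ℝ := fun v => if C v = 0 then 1 else -1 with hp
    have hpp : ∀ i, p i * p i = 1 := by
      intro i; simp only [hp]; split_ifs <;> norm_num
    have hP := diag_mem_unitary hpp
    have hconj : diagonal p * (D - A) * diagonal p = D + A := by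
      ext a b
      rw [Matrix.mul_diagonal, Matrix.diagonal_mul]
      by_cases hab : a = b
      · subst hab
        have : A a a = 0 := by simp [hA]
        rw [Matrix.sub_apply, Matrix.add_apply, this]
        linear_combination D a a * hpp a
      · have h0 : D a b = 0 := by simp [hD, hab]
        rw [Matrix.sub_apply, Matrix.add_apply, h0]
        by_cases hadj : G.Adj a b
        · have hne := C.valid hadj
          have : p a * p b = -1 := by
            simp only [hp]
            split_ifs with h1 h2 h2
            · exact absurd (h1.trans h2.symm) hne
            · norm_num
            · norm_num
            · exfalso; apply hne; omega
          linear_combination (-A a b) * this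
        · have : A a b = 0 := by simp [hA, hadj]
          rw [this]; ring
    obtain ⟨Q, hQ, hQt⟩ := exists_trace_eq (adjMatrix_isHermitian G) 0
    rw [zero_smul, sub_zero, ← hE] at hQt
    have h1 := hup Q hQ
    have h2 := hup (diagonal p * Q * diagonal p) (mul_mem (mul_mem hP hQ) hP)
    have h3 : (diagonal p * Q * diagonal p * (D - A)).trace = (Q * (D + A)).trace := by
      rw [← hconj, mul_assoc, mul_assoc, Matrix.trace_mul_comm]
      simp only [mul_assoc]
    rw [h3, mul_add, Matrix.trace_add] at h2
    rw [mul_sub, Matrix.trace_sub] at h1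
    rw [abs_le] at h1 h2
    rw [← hA] at hQt
    linarith
  · obtain ⟨Q, hQ, hQt⟩ := exists_trace_eq (wLaplacian_isHermitian G w) c
    rw [← hQt, hM, mul_sub, Matrix.trace_sub]
    have h1 := trace_mul_diag_le hQ (fun v => w v - c)
    have h2 := hupA Q hQ
    rw [abs_le] at h1 h2
    rw [← hD] at h1
    linarith

theorem wLapEnergy_twoDeg_bounds (G : SimpleGraph V) [DecidableRel G.Adj]
    (hG : G.Colorable 2) :
    max ((Fintype.card V : ℝ) * meanDev (twoDeg G)) (graphEnergy G) ≤ wLapEnergy G (twoDeg G) ∧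
    wLapEnergy G (twoDeg G) ≤ (Fintype.card V : ℝ) * meanDev (twoDeg G) + graphEnergy G := by
  exact wLapEnergy_bounds G hG (twoDeg G)
end

section
/- Let G be a bipartite simple graph on n vertices. Then max{ n·MD_{deg²}(G), E(G) } ≤ LE_{deg²}(G) ≤ n·MD_{deg²}(G) + E(G), where deg² is the squared vertex degree weight. -/
open Matrix Finset

set_option linter.unusedSectionVars false

variable {V : Type*} [Fintype V] [DecidableEq V]

/-- The squared-degree vertex weight `deg²(u) = deg_G(u)²`. -/
def degSq (G : SimpleGraph V) [DecidableRel G.Adj] (u : V) : ℝ :=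
  (G.degree u : ℝ) ^ 2

lemma aux_spec (A : Matrix V V ℝ) (hA : A.IsHermitian) :
    ∃ U : Matrix V V ℝ, U * Uᵀ = 1 ∧ Uᵀ * U = 1 ∧ A = U * diagonal hA.eigenvalues * Uᵀ := by
  have h1 := Unitary.coe_mul_star_self hA.eigenvectorUnitary
  have h2 := Unitary.coe_star_mul_self hA.eigenvectorUnitary
  have h3 := hA.spectral_theorem
  rw [Unitary.conjStarAlgAut_apply] at h3
  simp only [Matrix.star_eq_conjTranspose, Matrix.conjTranspose_eq_transpose_of_trivial] at h1 h2 h3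
  exact ⟨_, h1, h2, h3⟩

lemma aux_pinch (M U P : Matrix V V ℝ) (d : V → ℝ) (hU : Uᵀ * U = 1) (hP : P * Pᵀ = 1)
    (hM : M = U * diagonal d * Uᵀ) : ∑ i, |(Pᵀ * M * P) i i| ≤ ∑ k, |d k| := by
  set W := Pᵀ * U with hW
  have hWW : Wᵀ * W = 1 := by
    rw [hW, transpose_mul, transpose_transpose, Matrix.mul_assoc, ← Matrix.mul_assoc P, hP,
      Matrix.one_mul, hU]
  have hE : Pᵀ * M * P = W * diagonal d * Wᵀ := by
    rw [hM, hW, transpose_mul, transpose_transpose]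
    simp only [Matrix.mul_assoc]
  have h1 : ∀ i, (Pᵀ * M * P) i i = ∑ k, W i k ^ 2 * d k := by
    intro i
    rw [hE, Matrix.mul_apply]
    refine Finset.sum_congr rfl fun k _ => ?_
    rw [Matrix.mul_diagonal, transpose_apply]; ring
  have h2 : ∀ k, ∑ i, W i k ^ 2 = 1 := by
    intro k
    have := congrFun (congrFun hWW k) k
    rw [Matrix.mul_apply, Matrix.one_apply_eq] at this
    rw [← this]
    refine Finset.sum_congr rfl fun i _ => ?_
    rw [transpose_apply]; ring
  calc ∑ i, |(Pᵀ * M * P) i i| ≤ ∑ i, ∑ k, W i k ^ 2 * |d k| := by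
        refine Finset.sum_le_sum fun i _ => ?_
        rw [h1]
        refine (Finset.abs_sum_le_sum_abs _ _).trans (le_of_eq ?_)
        refine Finset.sum_congr rfl fun k _ => ?_
        rw [abs_mul, abs_of_nonneg (sq_nonneg (W i k))]
    _ = ∑ k, |d k| := by
        rw [Finset.sum_comm]
        refine Finset.sum_congr rfl fun k _ => ?_
        rw [← Finset.sum_mul, h2, one_mul]

lemma aux_diag_s11 (M U : Matrix V V ℝ) (d : V → ℝ) (hU : Uᵀ * U = 1)
    (hM : M = U * diagonal d * Uᵀ) : Uᵀ * M * U = diagonal d := by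
  rw [hM]
  calc Uᵀ * (U * diagonal d * Uᵀ) * U = (Uᵀ * U) * diagonal d * (Uᵀ * U) := by
        simp only [Matrix.mul_assoc]
    _ = diagonal d := by rw [hU, Matrix.one_mul, Matrix.mul_one]

theorem wLapEnergy_degSq_bounds (G : SimpleGraph V) [DecidableRel G.Adj]
    (hG : G.Colorable 2) :
    max ((Fintype.card V : ℝ) * meanDev (degSq G)) (graphEnergy G) ≤ wLapEnergy G (degSq G) ∧
    wLapEnergy G (degSq G) ≤ (Fintype.card V : ℝ) * meanDev (degSq G) + graphEnergy G := by
  generalize degSq G = w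
  have hMD : (Fintype.card V : ℝ) * meanDev w = ∑ v, |w v - avgWeight w| := by
    unfold meanDev
    rcases isEmpty_or_nonempty V with h | h
    · simp
    · field_simp
  rw [hMD]
  unfold graphEnergy wLapEnergy
  generalize avgWeight w = c
  obtain ⟨U, hU1, hU2, hUA⟩ := aux_spec _ (adjMatrix_isHermitian G)
  obtain ⟨Q, hQ1, hQ2, hQL⟩ := aux_spec _ (wLaplacian_isHermitian G w)
  generalize (adjMatrix_isHermitian G).eigenvalues = a at *
  generalize (wLaplacian_isHermitian G w).eigenvalues = m at *
  set B : Matrix V V ℝ := diagonal (fun v => w v - c) with hB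
  set M : Matrix V V ℝ := B - G.adjMatrix ℝ with hMdef
  have hcd : ∀ f : V → ℝ, diagonal (fun v => f v - c) = diagonal f - c • (1 : Matrix V V ℝ) := by
    intro f
    rw [smul_one_eq_diagonal, diagonal_sub]
  have hM : M = Q * diagonal (fun k => m k - c) * Qᵀ := by
    rw [hcd, Matrix.mul_sub, Matrix.sub_mul, ← hQL, Matrix.mul_smul, Matrix.smul_mul,
      Matrix.mul_one, hQ1, hMdef, hB, hcd, wLaplacian]
    abel
  have hB1 : B = 1 * diagonal (fun v => w v - c) * 1ᵀ := by simp [hB]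
  refine ⟨max_le ?_ ?_, ?_⟩
  · have := aux_pinch M Q 1 _ hQ2 (by simp) hM
    simpa [hMdef, hB] using this
  · obtain ⟨C⟩ := hG
    set s : V → ℝ := fun v => if C v = 0 then 1 else -1 with hs
    have hss : ∀ v, s v * s v = 1 := by
      intro v; simp only [hs]; split_ifs <;> norm_num
    have hadj : ∀ u v, G.Adj u v → s u * s v = -1 := by
      intro u v h
      have := C.valid h
      simp only [hs]
      split_ifs <;> first | (exfalso; omega) | norm_num
    have hS2 : diagonal s * diagonal s = (1 : Matrix V V ℝ) := by
      rw [diagonal_mul_diagonal]; simp [hss]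
    have hSA : diagonal s * M * diagonal s = M + (2 : ℝ) • G.adjMatrix ℝ := by
      ext i j
      rw [Matrix.mul_diagonal, Matrix.diagonal_mul]
      by_cases hij : i = j
      · subst hij
        have := hss i
        simp [hMdef, hB]
        linear_combination (w i - c) * this
      · simp only [hMdef, hB, Matrix.sub_apply, Matrix.add_apply, Matrix.smul_apply, diagonal_apply_ne _ hij,
          SimpleGraph.adjMatrix_apply]
        split_ifs with h
        · have := hadj i j h
          simp
          linear_combination -this
        · simp
    have e1 := aux_pinch M Q U _ hQ2 hU1 hM
    have e2 := aux_pinch M Q (diagonal s * U) _ hQ2 (by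
      rw [transpose_mul, diagonal_transpose, Matrix.mul_assoc, ← Matrix.mul_assoc U, hU1,
        Matrix.one_mul, hS2]) hM
    have hd := aux_diag_s11 _ U a hU2 hUA
    have e3 : (diagonal s * U)ᵀ * M * (diagonal s * U) = Uᵀ * M * U + (2 : ℝ) • diagonal a := by
      calc _ = Uᵀ * (diagonal s * M * diagonal s) * U := by
            rw [transpose_mul, diagonal_transpose]; simp only [Matrix.mul_assoc]
        _ = _ := by
            rw [hSA, Matrix.mul_add, Matrix.add_mul, Matrix.mul_smul, Matrix.smul_mul, hd]
    have e4 : ∑ i, 2 * |a i| ≤ ∑ i, (|((diagonal s * U)ᵀ * M * (diagonal s * U)) i i|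
        + |(Uᵀ * M * U) i i|) := by
      refine Finset.sum_le_sum fun i _ => ?_
      rw [e3]
      have h := abs_sub ((Uᵀ * M * U + (2 : ℝ) • diagonal a) i i) ((Uᵀ * M * U) i i)
      have h' : (Uᵀ * M * U + (2 : ℝ) • diagonal a) i i - (Uᵀ * M * U) i i = 2 * a i := by
        simp
      rw [h', abs_mul, abs_two] at h
      exact h
    rw [← Finset.mul_sum, Finset.sum_add_distrib] at e4
    linarith
  · have hd := aux_diag_s11 M Q _ hQ2 hM
    have e1 := aux_pinch B 1 Q _ (by simp) hQ1 hB1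
    have e2 := aux_pinch _ U Q _ hU2 hQ1 hUA
    refine le_trans ?_ (add_le_add e1 e2)
    rw [← Finset.sum_add_distrib]
    refine Finset.sum_le_sum fun i _ => ?_
    have h : m i - c = (Qᵀ * B * Q) i i - (Qᵀ * G.adjMatrix ℝ * Q) i i := by
      have := congrFun (congrFun hd i) i
      rw [diagonal_apply_eq] at this
      rw [← this, hMdef, Matrix.mul_sub, Matrix.sub_mul, Matrix.sub_apply]
    rw [h]
    exact abs_sub _ _
end
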